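/- arXiv:2602.13755 — 2 statements merged into one kernel-verified Lean document; each statement's English description precedes it below -/
import Mathlib

section
/- Let D ⊂ ℝⁿ (n ≥ 2) be a domain, a ∈ ℝⁿ, and let Q : ℝⁿ → [0,∞] be locally integrable on ℝⁿ. Then the family 𝔉_{Q,a}(D) of all open discrete mappings f : D → ℝⁿ \ {a} satisfying the inverse Poletsky inequality with majorant Q at every point y₀ ∈ ℝⁿ is equicontinuous (with respect to the chordal metric on the target) at each point x₀ ∈ D. -/
open MeasureTheory Metric Set Filter Topology
open scoped ENNReal NNReal

noncomputable section
open scoped Classical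

/-- The (clamped) total-variation function of `γ` on `[a, b]`. -/
def varFun (n : ℕ) (γ : ℝ → EuclideanSpace ℝ (Fin n)) (a b t : ℝ) : ℝ :=
  (eVariationOn γ (Set.Icc a (max a (min t b)))).toReal

/-- The arc-length (Lebesgue–Stieltjes) integral `∫_γ ρ ds` of a Borel function
`ρ : ℝⁿ → [0,∞]` along the path `γ : [a, b] → ℝⁿ`, defined via the Lebesgue–Stieltjes
measure associated to the arc-length (variation) function of `γ`.  It is `∞` when `γ`
is not rectifiable. -/
def arcIntegral (n : ℕ) (ρ : EuclideanSpace ℝ (Fin n) → ℝ≥0∞)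
    (γ : ℝ → EuclideanSpace ℝ (Fin n)) (a b : ℝ) : ℝ≥0∞ :=
  if h : BoundedVariationOn γ (Set.Icc a b) ∧ Monotone (varFun n γ a b) then
    ∫⁻ t in Set.Icc a b, ρ (γ t) ∂h.2.stieltjesFunction.measure
  else ∞

/-- A (continuous) path in `ℝⁿ` defined on a compact interval `[a, b]`. -/
structure PathOn (n : ℕ) where
  a : ℝ
  b : ℝ
  hab : a ≤ b
  toFun : ℝ → EuclideanSpace ℝ (Fin n)
  cont : ContinuousOn toFun (Set.Icc a b)

/-- A Borel function `ρ : ℝⁿ → [0,∞]` is admissible for a family `Γ` of paths if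
`∫_γ ρ ds ≥ 1` for every (locally rectifiable) path `γ ∈ Γ`. -/
def IsAdmissibleFor (n : ℕ) (ρ : EuclideanSpace ℝ (Fin n) → ℝ≥0∞)
    (Γ : Set (PathOn n)) : Prop :=
  Measurable ρ ∧ ∀ γ ∈ Γ, 1 ≤ arcIntegral n ρ γ.toFun γ.a γ.b

/-- The (conformal) modulus `M(Γ)` of a family of paths in `ℝⁿ`. -/
def modulus (n : ℕ) (Γ : Set (PathOn n)) : ℝ≥0∞ :=
  ⨅ (ρ : EuclideanSpace ℝ (Fin n) → ℝ≥0∞) (_ : IsAdmissibleFor n ρ Γ),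
    ∫⁻ x, ρ x ^ n

/-- The spherical annulus `A(y₀, r₁, r₂) = {y : r₁ < |y − y₀| < r₂}`. -/
def annulus (n : ℕ) (y₀ : EuclideanSpace ℝ (Fin n)) (r₁ r₂ : ℝ) :
    Set (EuclideanSpace ℝ (Fin n)) :=
  {y | r₁ < dist y y₀ ∧ dist y y₀ < r₂}

/-- `Γ(E, F, G)`: the family of all paths `γ : [a,b] → ℝⁿ` with `γ(a) ∈ E`,
`γ(b) ∈ F` and `γ(t) ∈ G` for `t ∈ (a, b)`. -/
def pathsBetween (n : ℕ) (E F G : Set (EuclideanSpace ℝ (Fin n))) : Set (PathOn n) :=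
  {γ | γ.toFun γ.a ∈ E ∧ γ.toFun γ.b ∈ F ∧ ∀ t ∈ Set.Ioo γ.a γ.b, γ.toFun t ∈ G}

/-- `Γ_f(y₀, r₁, r₂)`: the family of all paths `γ` in `D` such that
`f ∘ γ ∈ Γ(S(y₀,r₁), S(y₀,r₂), A(y₀,r₁,r₂))`. -/
def liftedFamily (n : ℕ) (D : Set (EuclideanSpace ℝ (Fin n)))
    (f : EuclideanSpace ℝ (Fin n) → EuclideanSpace ℝ (Fin n))
    (y₀ : EuclideanSpace ℝ (Fin n)) (r₁ r₂ : ℝ) : Set (PathOn n) :=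
  {γ | (∀ t ∈ Set.Icc γ.a γ.b, γ.toFun t ∈ D) ∧
    f (γ.toFun γ.a) ∈ Metric.sphere y₀ r₁ ∧ f (γ.toFun γ.b) ∈ Metric.sphere y₀ r₂ ∧
    ∀ t ∈ Set.Ioo γ.a γ.b, f (γ.toFun t) ∈ annulus n y₀ r₁ r₂}

/-- `f` satisfies the inverse Poletsky inequality at `y₀` with majorant `Q`. -/
def InvPoletsky (n : ℕ) (D : Set (EuclideanSpace ℝ (Fin n)))
    (f : EuclideanSpace ℝ (Fin n) → EuclideanSpace ℝ (Fin n))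
    (Q : EuclideanSpace ℝ (Fin n) → ℝ≥0∞) (y₀ : EuclideanSpace ℝ (Fin n)) : Prop :=
  ∃ r₀ > (0 : ℝ), ∀ r₁ r₂ : ℝ, 0 < r₁ → r₁ < r₂ → r₂ < r₀ →
    ∀ η : ℝ → ℝ≥0∞, Measurable η → 1 ≤ ∫⁻ r in Set.Ioo r₁ r₂, η r →
      modulus n (liftedFamily n D f y₀ r₁ r₂) ≤
        ∫⁻ y in (f '' D) ∩ annulus n y₀ r₁ r₂, Q y * η (dist y y₀) ^ n

/-- `f` is discrete on `D`: every fiber has no accumulation point in `D`. -/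
def IsDiscreteOn (n : ℕ) (D : Set (EuclideanSpace ℝ (Fin n)))
    (f : EuclideanSpace ℝ (Fin n) → EuclideanSpace ℝ (Fin n)) : Prop :=
  ∀ y, ∀ x ∈ D, ¬ AccPt x (Filter.principal {z | z ∈ D ∧ f z = y})

/-- `f` is open on `D`: the image of every open subset of `D` is open. -/
def IsOpenOn (n : ℕ) (D : Set (EuclideanSpace ℝ (Fin n)))
    (f : EuclideanSpace ℝ (Fin n) → EuclideanSpace ℝ (Fin n)) : Prop :=
  ∀ U : Set (EuclideanSpace ℝ (Fin n)), IsOpen U → U ⊆ D → IsOpen (f '' U)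

/-- The chordal (spherical) metric `h(x,y) = |x−y|/(√(1+|x|²)·√(1+|y|²))`. -/
def chordal (n : ℕ) (x y : EuclideanSpace ℝ (Fin n)) : ℝ :=
  dist x y / (Real.sqrt (1 + ‖x‖ ^ 2) * Real.sqrt (1 + ‖y‖ ^ 2))

/-- A family of mappings of `D` is equicontinuous at `x₀ ∈ D` w.r.t. the chordal
metric on the target. -/
def EquicontinuousAtPt (n : ℕ) (D : Set (EuclideanSpace ℝ (Fin n)))
    (𝓕 : Set (EuclideanSpace ℝ (Fin n) → EuclideanSpace ℝ (Fin n)))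
    (x₀ : EuclideanSpace ℝ (Fin n)) : Prop :=
  ∀ ε > (0 : ℝ), ∃ δ > (0 : ℝ), ∀ f ∈ 𝓕, ∀ x ∈ D, dist x x₀ < δ →
    chordal n (f x) (f x₀) < ε

lemma Monotone.stieltjesFunction_apply_of_continuous {F : ℝ → ℝ} (hF : Monotone F)
    (hc : Continuous F) (t : ℝ) : hF.stieltjesFunction t = F t := by
  rw [Monotone.stieltjesFunction_eq]
  exact (hc.continuousAt.continuousWithinAt (s := Set.Ici t)).rightLim_eq

lemma clamp_sub_clamp {a b c d : ℝ} (hab : a ≤ b) (hcd : c ≤ d) (h : max c a ≤ min d b) :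
    max a (min d b) - max a (min c b) = min d b - max c a := by
  grind

lemma clamp_sub_clamp_of_le {a b c d : ℝ} (hab : a ≤ b) (hcd : c ≤ d)
    (h : min d b ≤ max c a) : max a (min d b) - max a (min c b) = 0 := by
  grind

lemma eVariationOn_affine {n : ℕ} (x v : EuclideanSpace ℝ (Fin n)) {a c : ℝ} (hac : a ≤ c) :
    eVariationOn (fun s : ℝ => x + s • v) (Set.Icc a c) = ENNReal.ofReal (‖v‖ * (c - a)) := by
  apply le_antisymm
  · have hL : LipschitzOnWith ‖v‖₊ (fun s : ℝ => x + s • v) Set.univ := by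
      refine LipschitzOnWith.of_dist_le_mul fun s _ t _ => ?_
      rw [dist_add_left, dist_eq_norm, ← sub_smul, norm_smul, mul_comm, coe_nnnorm,
        Real.dist_eq, Real.norm_eq_abs]
    have h := hL.comp_eVariationOn_le (g := fun s : ℝ => s) (s := Set.Icc a c)
      (Set.mapsTo_univ _ _)
    have h2 : eVariationOn (fun s : ℝ => s) (Set.Icc a c) = ENNReal.ofReal (c - a) := by
      have := MonotoneOn.eVariationOn_eq (f := fun s : ℝ => s) (s := Set.Icc a c) (a := a) (b := c)
        (fun _ _ _ _ h => h) (left_mem_Icc.2 hac) (right_mem_Icc.2 hac)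
      rwa [Set.inter_self] at this
    rw [h2] at h
    refine h.trans (le_of_eq ?_)
    rw [ENNReal.ofReal_mul (norm_nonneg _), ofReal_norm]; rfl
  · have h := eVariationOn.edist_le (fun s : ℝ => x + s • v) (right_mem_Icc.2 hac)
      (left_mem_Icc.2 hac)
    refine le_trans (le_of_eq ?_) h
    rw [edist_dist, dist_add_left, dist_eq_norm, ← sub_smul, norm_smul, mul_comm,
      Real.norm_of_nonneg (sub_nonneg.2 hac)]

lemma varFun_affine {n : ℕ} (x v : EuclideanSpace ℝ (Fin n)) (a b t : ℝ) :
    varFun n (fun s : ℝ => x + s • v) a b t = ‖v‖ * (max a (min t b) - a) := by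
  rw [varFun, eVariationOn_affine x v (le_max_left _ _), ENNReal.toReal_ofReal]
  exact mul_nonneg (norm_nonneg _) (sub_nonneg.2 (le_max_left _ _))

/-- Along an affine path the arc-length integral is the Lebesgue integral times the speed. -/
lemma arcIntegral_affine {n : ℕ} (ρ : EuclideanSpace ℝ (Fin n) → ℝ≥0∞)
    (x v : EuclideanSpace ℝ (Fin n)) {a b : ℝ} (hab : a ≤ b) :
    arcIntegral n ρ (fun s : ℝ => x + s • v) a b =
      ENNReal.ofReal ‖v‖ * ∫⁻ t in Set.Icc a b, ρ (x + t • v) := by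
  have hfun : varFun n (fun s : ℝ => x + s • v) a b =
      fun t => ‖v‖ * (max a (min t b) - a) := funext fun t => varFun_affine x v a b t
  have hmono : Monotone (varFun n (fun s : ℝ => x + s • v) a b) := by
    rw [hfun]
    intro s t hst
    have : max a (min s b) ≤ max a (min t b) := by gcongr
    dsimp only
    gcongr
  have hbv : BoundedVariationOn (fun s : ℝ => x + s • v) (Set.Icc a b) := by
    rw [BoundedVariationOn, eVariationOn_affine x v hab]
    exact ENNReal.ofReal_ne_top
  have h : BoundedVariationOn (fun s : ℝ => x + s • v) (Set.Icc a b) ∧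
    Monotone (varFun n (fun s : ℝ => x + s • v) a b) := ⟨hbv, hmono⟩
  rw [arcIntegral, dif_pos h]
  have hval : ∀ t, h.2.stieltjesFunction t = ‖v‖ * (max a (min t b) - a) := by
    intro t
    rw [h.2.stieltjesFunction_apply_of_continuous (by rw [hfun]; fun_prop), hfun]
  have hmeas : h.2.stieltjesFunction.measure =
      ENNReal.ofReal ‖v‖ • volume.restrict (Set.Icc a b) := by
    refine Measure.ext_of_Ioc _ _ fun c d hcd => ?_
    rw [← restrict_Ioc_eq_restrict_Icc,
      StieltjesFunction.measure_Ioc, hval, hval, Measure.smul_apply,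
      Measure.restrict_apply measurableSet_Ioc, smul_eq_mul, ← mul_sub,
      ENNReal.ofReal_mul (norm_nonneg _)]
    congr 1
    rw [Set.Ioc_inter_Ioc, Real.volume_Ioc]
    rcases le_total (min d b) (max c a) with h1 | h1
    · rw [ENNReal.ofReal_of_nonpos (sub_nonpos.2 h1), ENNReal.ofReal_of_nonpos]
      have := clamp_sub_clamp_of_le hab hcd.le h1
      linarith
    · congr 1
      have := clamp_sub_clamp hab hcd.le h1
      linarith
  rw [hmeas, Measure.restrict_smul, Measure.restrict_restrict measurableSet_Icc, Set.inter_self,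
    lintegral_smul_measure, smul_eq_mul]

/-- A continuous function that goes from below `p` to above `q` has a crossing of `[p, q]`. -/
lemma exists_crossing {ψ : ℝ → ℝ} {a b p q : ℝ} (hab : a ≤ b) (hψ : ContinuousOn ψ (Set.Icc a b))
    (ha : ψ a ≤ p) (hb : q ≤ ψ b) (hpq : p < q) :
    ∃ c d, a ≤ c ∧ c < d ∧ d ≤ b ∧ ψ c = p ∧ ψ d = q ∧ ∀ t ∈ Set.Ioo c d, p < ψ t ∧ ψ t < q := by
  have hS : IsCompact (Set.Icc a b ∩ ψ ⁻¹' Set.Ici q) :=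
    isCompact_Icc.of_isClosed_subset (hψ.preimage_isClosed_of_isClosed isClosed_Icc isClosed_Ici)
      Set.inter_subset_left
  obtain ⟨d, ⟨hd, hdq⟩, hdmin⟩ := hS.exists_isLeast ⟨b, right_mem_Icc.2 hab, hb⟩
  have hψ' : ContinuousOn ψ (Set.Icc a d) := hψ.mono (Set.Icc_subset_Icc_right hd.2)
  have hT : IsCompact (Set.Icc a d ∩ ψ ⁻¹' Set.Iic p) :=
    isCompact_Icc.of_isClosed_subset (hψ'.preimage_isClosed_of_isClosed isClosed_Icc isClosed_Iic)
      Set.inter_subset_left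
  obtain ⟨c, ⟨hc, hcp⟩, hcmax⟩ := hT.exists_isGreatest ⟨a, left_mem_Icc.2 hd.1, ha⟩
  simp only [Set.mem_preimage, Set.mem_Ici, Set.mem_Iic] at hdq hcp
  have hcd : c < d := lt_of_le_of_ne hc.2 (by rintro rfl; linarith)
  have hlow : ∀ t ∈ Set.Icc a d, c < t → p < ψ t := fun t ht hct => by
    by_contra! h
    exact absurd (hcmax ⟨ht, h⟩) (not_le.2 hct)
  have hup : ∀ t ∈ Set.Icc a b, t < d → ψ t < q := fun t ht htd => by
    by_contra! h
    exact absurd (hdmin ⟨ht, h⟩) (not_le.2 htd)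
  refine ⟨c, d, hc.1, hcd, hd.2, le_antisymm hcp ?_, le_antisymm ?_ hdq, fun t ht =>
    ⟨hlow t ⟨hc.1.trans ht.1.le, ht.2.le⟩ ht.1,
      hup t ⟨hc.1.trans ht.1.le, ht.2.le.trans hd.2⟩ ht.2⟩⟩
  · by_contra! h
    obtain ⟨t, ht, htp⟩ := intermediate_value_Icc hcd.le
      (hψ'.mono (Set.Icc_subset_Icc_left hc.1)) ⟨h.le, (hpq.le.trans hdq)⟩
    have hct : c < t := lt_of_le_of_ne ht.1 (by rintro rfl; linarith)
    exact absurd htp (hlow t ⟨hc.1.trans ht.1, ht.2⟩ hct).ne'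
  · by_contra! h
    obtain ⟨t, ht, htq⟩ := intermediate_value_Icc hcd.le
      (hψ'.mono (Set.Icc_subset_Icc_left hc.1)) ⟨hcp.trans hpq.le, h.le⟩
    have htd : t < d := lt_of_le_of_ne ht.2 (by rintro rfl; linarith)
    exact absurd htq (hup t ⟨hc.1.trans ht.1, ht.2.trans hd.2⟩ htd).ne

lemma one_le_lintegral_crossing_of_le {n : ℕ} {D : Set (EuclideanSpace ℝ (Fin n))}
    {f : EuclideanSpace ℝ (Fin n) → EuclideanSpace ℝ (Fin n)} (hf : ContinuousOn f D)
    {y : EuclideanSpace ℝ (Fin n)} {r₁ r₂ : ℝ} (hr : r₁ < r₂)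
    {ρ : EuclideanSpace ℝ (Fin n) → ℝ≥0∞}
    (hρ : IsAdmissibleFor n ρ (liftedFamily n D f y r₁ r₂))
    {x v : EuclideanSpace ℝ (Fin n)} {a b : ℝ} (hab : a ≤ b)
    (hD : ∀ t ∈ Set.Icc a b, x + t • v ∈ D)
    (ha : dist (f (x + a • v)) y ≤ r₁) (hb : r₂ ≤ dist (f (x + b • v)) y) :
    ∃ c d, a ≤ c ∧ c < d ∧ d ≤ b ∧ (∀ t ∈ Set.Icc c d, dist (f (x + t • v)) y ≤ r₂) ∧
      1 ≤ ENNReal.ofReal ‖v‖ * ∫⁻ t in Set.Icc c d, ρ (x + t • v) := by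
  have hγ : Continuous fun t : ℝ => x + t • v := by fun_prop
  have hψ : ContinuousOn (fun t : ℝ => dist (f (x + t • v)) y) (Set.Icc a b) := by
    have : ContinuousOn (fun t : ℝ => f (x + t • v)) (Set.Icc a b) :=
      hf.comp hγ.continuousOn hD
    exact (continuous_id.dist continuous_const).comp_continuousOn this
  obtain ⟨c, d, hac, hcd, hdb, hc, hd, hin⟩ := exists_crossing hab hψ ha hb hr
  refine ⟨c, d, hac, hcd, hdb, fun t ht => ?_, ?_⟩
  · rcases eq_or_lt_of_le ht.1 with rfl | h1
    · rw [hc]; exact hr.le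
    rcases eq_or_lt_of_le ht.2 with rfl | h2
    · exact hd.le
    exact (hin t ⟨h1, h2⟩).2.le
  · rw [← arcIntegral_affine ρ x v hcd.le]
    exact hρ.2 ⟨c, d, hcd.le, fun t => x + t • v, hγ.continuousOn⟩
      ⟨fun t ht => hD t ⟨hac.trans ht.1, ht.2.trans hdb⟩, hc, hd, hin⟩

/-- An affine path whose image under `f` meets both the `r₁`-ball and the complement of the `r₂`-ball
contains a crossing subpath, whose length in any admissible metric is at least one. -/
lemma one_le_lintegral_crossing {n : ℕ} {D : Set (EuclideanSpace ℝ (Fin n))}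
    {f : EuclideanSpace ℝ (Fin n) → EuclideanSpace ℝ (Fin n)} (hf : ContinuousOn f D)
    {y : EuclideanSpace ℝ (Fin n)} {r₁ r₂ : ℝ} (hr : r₁ < r₂)
    {ρ : EuclideanSpace ℝ (Fin n) → ℝ≥0∞}
    (hρ : IsAdmissibleFor n ρ (liftedFamily n D f y r₁ r₂))
    {x v : EuclideanSpace ℝ (Fin n)} {a b : ℝ}
    (hD : ∀ t ∈ Set.Icc a b, x + t • v ∈ D) {t₀ t₁ : ℝ} (ht₀ : t₀ ∈ Set.Icc a b)
    (ht₁ : t₁ ∈ Set.Icc a b)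
    (h₀ : dist (f (x + t₀ • v)) y ≤ r₁) (h₁ : r₂ ≤ dist (f (x + t₁ • v)) y) :
    ∃ c d, a ≤ c ∧ c < d ∧ d ≤ b ∧ (∀ t ∈ Set.Icc c d, dist (f (x + t • v)) y ≤ r₂) ∧
      1 ≤ ENNReal.ofReal ‖v‖ * ∫⁻ t in Set.Icc c d, ρ (x + t • v) := by
  rcases le_total t₀ t₁ with hle | hle
  · obtain ⟨c, d, hc, hcd, hd, h⟩ := one_le_lintegral_crossing_of_le hf hr hρ hle
      (fun t ht => hD t ⟨ht₀.1.trans ht.1, ht.2.trans ht₁.2⟩) h₀ h₁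
    exact ⟨c, d, ht₀.1.trans hc, hcd, hd.trans ht₁.2, h⟩
  · obtain ⟨c, d, hc, hcd, hd, h, h'⟩ := one_le_lintegral_crossing_of_le (v := -v) hf hr hρ
      (neg_le_neg hle) (fun t ht => by
        have := hD (-t) ⟨by linarith [ht₁.1, ht.2], by linarith [ht₀.2, ht.1]⟩
        simpa using this) (by simpa using h₀) (by simpa using h₁)
    refine ⟨-d, -c, by linarith [ht₁.1], neg_lt_neg hcd, by linarith [ht₀.2], fun t ht => ?_, ?_⟩
    · have := h (-t) ⟨by linarith [ht.2], by linarith [ht.1]⟩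
      simpa using this
    · refine h'.trans (le_of_eq ?_)
      rw [norm_neg]
      congr 1
      have hmp := (Measure.measurePreserving_neg (volume : Measure ℝ)).setLIntegral_comp_preimage_emb
        (MeasurableEquiv.neg ℝ).measurableEmbedding (fun t => ρ (x + t • v)) (Set.Icc (-d) (-c))
      rw [← hmp]
      simp

/-- A locally finite measure dominating Lebesgue measure is doubling at every point along a
sequence of radii tending to zero. -/
lemma exists_doubling_radius {n : ℕ} (μ : Measure (EuclideanSpace ℝ (Fin n))) (hμ : volume ≤ μ)
    (y : EuclideanSpace ℝ (Fin n)) {s : ℝ} (hs : 0 < s) (hfin : μ (closedBall y s) ≠ ∞) :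
    ∃ r, 0 < r ∧ r ≤ s ∧ μ (closedBall y (10 * r)) ≤ 2 * 10 ^ n * μ (closedBall y r) := by
  by_contra! h
  have key : ∀ k : ℕ, (2 * 10 ^ n : ℝ≥0∞) ^ k * μ (closedBall y (s / 10 ^ k)) ≤
      μ (closedBall y s) := by
    intro k
    induction k with
    | zero => simp
    | succ k ih =>
      refine le_trans ?_ ih
      have h10 : (1 : ℝ) ≤ 10 ^ (k + 1) := one_le_pow₀ (by norm_num)
      have := h (s / 10 ^ (k + 1)) (by positivity) (div_le_self hs.le h10)
      rw [show 10 * (s / 10 ^ (k + 1)) = s / 10 ^ k by rw [pow_succ]; field_simp] at this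
      rw [pow_succ, mul_assoc]
      gcongr
  have hv : volume (ball (0 : EuclideanSpace ℝ (Fin n)) 1) ≠ 0 :=
    (measure_ball_pos volume _ one_pos).ne'
  set c : ℝ≥0∞ := ENNReal.ofReal (s ^ n) * volume (ball (0 : EuclideanSpace ℝ (Fin n)) 1) with hc
  have hc0 : c ≠ 0 := mul_ne_zero (ENNReal.ofReal_pos.2 (by positivity)).ne' hv
  have key2 : ∀ k : ℕ, (2 : ℝ≥0∞) ^ k * c ≤ μ (closedBall y s) := by
    intro k
    refine le_trans (le_of_eq ?_) (le_trans (mul_le_mul_right (hμ _) _) (key k))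
    have h10 : ((10 : ℝ≥0∞) ^ n) ^ k * ENNReal.ofReal ((s / 10 ^ k) ^ n) =
        ENNReal.ofReal (s ^ n) := by
      rw [show (10 : ℝ≥0∞) = ENNReal.ofReal 10 by norm_num, ← ENNReal.ofReal_pow (by norm_num),
        ← ENNReal.ofReal_pow (by positivity), ← ENNReal.ofReal_mul (by positivity)]
      congr 1
      rw [div_pow, ← pow_mul, ← pow_mul, mul_comm k n]
      field_simp
    rw [Measure.addHaar_closedBall _ _ (by positivity), finrank_euclideanSpace_fin, hc,
      mul_pow, mul_assoc, ← h10]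
    ring
  obtain ⟨N, hN⟩ := ENNReal.exists_nat_mul_gt hc0 hfin
  refine absurd (key2 N) (not_le.2 (hN.trans_le ?_))
  gcongr
  exact_mod_cast Nat.lt_two_pow_self.le

/-- If `f` satisfies the inverse Poletsky inequality at `y`, then at arbitrarily small doubling
scales there is an admissible metric whose energy is controlled by the mass of the ball. -/
lemma InvPoletsky.exists_admissible {n : ℕ} {D : Set (EuclideanSpace ℝ (Fin n))}
    {f : EuclideanSpace ℝ (Fin n) → EuclideanSpace ℝ (Fin n)}
    {Q : EuclideanSpace ℝ (Fin n) → ℝ≥0∞}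
    (hQloc : ∀ K : Set (EuclideanSpace ℝ (Fin n)), IsCompact K → (∫⁻ y in K, Q y) < ∞)
    {y : EuclideanSpace ℝ (Fin n)} (hP : InvPoletsky n D f Q y)
    {μ : Measure (EuclideanSpace ℝ (Fin n))} (hμ : volume ≤ μ)
    (hμQ : ∀ r, μ (closedBall y r) = ∫⁻ z in closedBall y r, (Q z + 1))
    {s : ℝ} (hs : 0 < s) :
    ∃ (r : ℝ) (ρ : EuclideanSpace ℝ (Fin n) → ℝ≥0∞), 0 < r ∧ r < s ∧
      IsAdmissibleFor n ρ (liftedFamily n D f y (5 * r) (10 * r)) ∧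
      ENNReal.ofReal r ^ n * ∫⁻ x, ρ x ^ n ≤ 2 * 10 ^ n * μ (closedBall y r) := by
  obtain ⟨r₀, hr₀, hP⟩ := hP
  have hfin : ∀ t, μ (closedBall y t) ≠ ∞ := fun t => by
    rw [hμQ, lintegral_add_right _ measurable_const, lintegral_one, Measure.restrict_apply_univ]
    exact ENNReal.add_ne_top.2 ⟨(hQloc _ (isCompact_closedBall y t)).ne,
      measure_closedBall_lt_top.ne⟩
  obtain ⟨r, hr, hrs, hdoub⟩ := exists_doubling_radius μ hμ y
    (show 0 < min (s / 2) (r₀ / 20) by positivity) (hfin _)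
  have hrs' : r < s := by linarith [hrs.trans (min_le_left _ _)]
  have hrr : 10 * r < r₀ := by linarith [hrs.trans (min_le_right _ _)]
  have hη : (1 : ℝ≥0∞) ≤ ∫⁻ _ in Set.Ioo (5 * r) (10 * r), ENNReal.ofReal (1 / r) := by
    rw [setLIntegral_const, Real.volume_Ioo, ← ENNReal.ofReal_mul (by positivity),
      ENNReal.one_le_ofReal]
    field_simp
    linarith
  have hmod := hP (5 * r) (10 * r) (by positivity) (by linarith) hrr
    (fun _ => ENNReal.ofReal (1 / r)) measurable_const hη
  have hlt : modulus n (liftedFamily n D f y (5 * r) (10 * r)) <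
      ENNReal.ofReal (1 / r) ^ n * μ (closedBall y (10 * r)) := by
    have hsub : (f '' D) ∩ annulus n y (5 * r) (10 * r) ⊆ closedBall y (10 * r) :=
      fun z hz => mem_closedBall.2 hz.2.2.le
    have hQfin := (hQloc _ (isCompact_closedBall y (10 * r))).ne
    have hc0 : ENNReal.ofReal (1 / r) ^ n ≠ 0 :=
      pow_ne_zero _ (ENNReal.ofReal_pos.2 (by positivity)).ne'
    have hct : ENNReal.ofReal (1 / r) ^ n ≠ ∞ := ENNReal.pow_ne_top ENNReal.ofReal_ne_top
    calc _ ≤ _ := hmod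
      _ ≤ ∫⁻ z in closedBall y (10 * r), Q z * ENNReal.ofReal (1 / r) ^ n :=
          lintegral_mono_set hsub
      _ = ENNReal.ofReal (1 / r) ^ n * ∫⁻ z in closedBall y (10 * r), Q z := by
          rw [lintegral_mul_const' _ _ hct, mul_comm]
      _ < _ := by
          rw [ENNReal.mul_lt_mul_iff_right hc0 hct, hμQ, lintegral_add_right _ measurable_const,
            lintegral_one, Measure.restrict_apply_univ]
          exact ENNReal.lt_add_right hQfin
            (measure_closedBall_pos volume _ (by positivity)).ne'
  rw [modulus, iInf_lt_iff] at hlt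
  obtain ⟨ρ, hlt⟩ := hlt
  obtain ⟨hρ, hlt⟩ := iInf_lt_iff.1 hlt
  refine ⟨r, ρ, hr, hrs', hρ, ?_⟩
  calc ENNReal.ofReal r ^ n * ∫⁻ x, ρ x ^ n
      ≤ ENNReal.ofReal r ^ n * (ENNReal.ofReal (1 / r) ^ n * μ (closedBall y (10 * r))) := by
        gcongr
    _ = μ (closedBall y (10 * r)) := by
        rw [← mul_assoc, ← mul_pow, ← ENNReal.ofReal_mul hr.le, mul_one_div_cancel hr.ne',
          ENNReal.ofReal_one, one_pow, one_mul]
    _ ≤ _ := hdoub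

/-- The local inverse Poletsky inequalities glue to a single metric `σ` of controlled energy such
that any segment on which `f` oscillates by `L` near the ball of radius `R` has `σ`-length at least
a constant multiple of `L`. The scale at which the inequalities hold plays no role. -/
lemma exists_energy_density {n : ℕ} (hn : n ≠ 0) {D : Set (EuclideanSpace ℝ (Fin n))}
    {f : EuclideanSpace ℝ (Fin n) → EuclideanSpace ℝ (Fin n)} (hf : ContinuousOn f D)
    {Q : EuclideanSpace ℝ (Fin n) → ℝ≥0∞}
    (hQloc : ∀ K : Set (EuclideanSpace ℝ (Fin n)), IsCompact K → (∫⁻ y in K, Q y) < ∞)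
    (hP : ∀ y, InvPoletsky n D f Q y) (R : ℝ) {L : ℝ} (hL : 0 < L) :
    ∃ σ : EuclideanSpace ℝ (Fin n) → ℝ≥0∞, Measurable σ ∧
      ∫⁻ x, σ x ^ n ≤ 2 * 10 ^ n * ∫⁻ y in closedBall 0 (R + L + L), (Q y + 1) ∧
      ∀ x v : EuclideanSpace ℝ (Fin n), (∀ t ∈ Set.Icc (0 : ℝ) 1, x + t • v ∈ D) →
        ∀ τ ∈ Set.Icc (0 : ℝ) 1, ∀ τ' ∈ Set.Icc (0 : ℝ) 1, ‖f (x + τ • v)‖ ≤ R →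
          L ≤ dist (f (x + τ' • v)) (f (x + τ • v)) →
          ENNReal.ofReal L ≤
            80 * (ENNReal.ofReal ‖v‖ * ∫⁻ t in Set.Icc (0 : ℝ) 1, σ (x + t • v)) := by
  set μ : Measure (EuclideanSpace ℝ (Fin n)) := volume.withDensity fun y => Q y + 1 with hμdef
  have hμQ : ∀ s, MeasurableSet s → μ s = ∫⁻ z in s, (Q z + 1) := fun s hs => by
    rw [hμdef, withDensity_apply _ hs]
  have hμ : volume ≤ μ := Measure.le_iff.2 fun s hs => by
    rw [hμQ s hs]
    calc volume s = ∫⁻ _ in s, 1 := by simp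
      _ ≤ _ := lintegral_mono fun z => le_add_self
  choose r ρ hr hrs hρ hE using fun y => (hP y).exists_admissible hQloc hμ
    (fun t => hμQ _ measurableSet_closedBall) (show 0 < L / 20 by positivity)
  obtain ⟨u, huK, hudisj, hucov⟩ := Vitali.exists_disjoint_subfamily_covering_enlargement_closedBall
    (closedBall (0 : EuclideanSpace ℝ (Fin n)) (R + L)) id r (L / 20) (fun y _ => (hrs y).le) 5
    (by norm_num)
  simp only [id] at hudisj hucov
  have huc : u.Countable := hudisj.countable_of_nonempty_interior fun y _ =>
    ⟨y, ball_subset_interior_closedBall (mem_ball_self (hr y))⟩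
  have : Countable u := huc.to_subtype
  have hterm : ∀ i : u, Measurable fun x => ENNReal.ofReal (r i) * ρ i x := fun i =>
    (hρ i).1.const_mul _
  refine ⟨fun x => ⨆ i : u, ENNReal.ofReal (r i) * ρ i x, Measurable.iSup hterm, ?_, ?_⟩
  · calc ∫⁻ x, (⨆ i : u, ENNReal.ofReal (r i) * ρ i x) ^ n
        ≤ ∫⁻ x, ∑' i : u, (ENNReal.ofReal (r i) * ρ i x) ^ n := by
          refine lintegral_mono fun x => ?_
          dsimp only
          rw [ENNReal.iSup_pow_of_ne_zero hn]
          exact iSup_le fun i => ENNReal.le_tsum i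
      _ = ∑' i : u, ∫⁻ x, (ENNReal.ofReal (r i) * ρ i x) ^ n :=
          lintegral_tsum fun i => ((hterm i).pow_const n).aemeasurable
      _ ≤ ∑' i : u, 2 * 10 ^ n * μ (closedBall i (r i)) := by
          refine ENNReal.tsum_le_tsum fun i => ?_
          simp_rw [mul_pow]
          rw [lintegral_const_mul _ ((hρ i).1.pow_const n)]
          exact hE i
      _ = 2 * 10 ^ n * ∑' i : u, μ (closedBall i (r i)) := ENNReal.tsum_mul_left
      _ = 2 * 10 ^ n * μ (⋃ i ∈ u, closedBall i (r i)) := by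
          rw [measure_biUnion huc hudisj fun i _ => measurableSet_closedBall]
      _ ≤ 2 * 10 ^ n * μ (closedBall 0 (R + L + L)) := by
          gcongr
          refine Set.iUnion₂_subset fun i hi => ?_
          have h1 := mem_closedBall.1 (huK hi)
          exact closedBall_subset_closedBall' (by linarith [hrs i])
      _ = _ := by rw [hμQ _ measurableSet_closedBall]
  intro x v hD τ hτ τ' hτ' hR hLd
  set σ : EuclideanSpace ℝ (Fin n) → ℝ≥0∞ := fun x => ⨆ i : u, ENNReal.ofReal (r i) * ρ i x
    with hσ
  set φ : ℝ → EuclideanSpace ℝ (Fin n) := fun t => f (x + t • v) with hφ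
  have hγ : Continuous fun t : ℝ => x + t • v := by fun_prop
  have hφc : ContinuousOn φ (Set.Icc 0 1) := hf.comp hγ.continuousOn hD
  set T : Set (EuclideanSpace ℝ (Fin n)) :=
    {i ∈ u | ∃ t ∈ Set.Icc (0 : ℝ) 1, dist (φ t) i ≤ 5 * r i} with hT
  have hcross : ∀ i ∈ T, ∃ c d, 0 ≤ c ∧ c < d ∧ d ≤ 1 ∧
      (∀ t ∈ Set.Icc c d, dist (φ t) i ≤ 10 * r i) ∧
      1 ≤ ENNReal.ofReal ‖v‖ * ∫⁻ t in Set.Icc c d, ρ i (x + t • v) := by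
    rintro i ⟨-, t, ht, hti⟩
    have hri := hr i
    have hrsi := hrs i
    obtain ⟨t₁, ht₁, ht₁i⟩ : ∃ t₁ ∈ Set.Icc (0 : ℝ) 1, 10 * r i ≤ dist (φ t₁) i := by
      by_contra! h
      have h1 := h τ hτ
      have h2 := h τ' hτ'
      have h3 := dist_triangle_right (φ τ') (φ τ) i
      have h4 : L ≤ dist (φ τ') (φ τ) := hLd
      linarith
    exact one_le_lintegral_crossing hf (by linarith) (hρ i) hD ht ht₁ hti ht₁i
  choose! c d hc hcd hd hball hone using hcross
  obtain ⟨w, hwT, hwdisj, hwcov⟩ := Vitali.exists_disjoint_subfamily_covering_enlargement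
    (fun i => Set.Icc (c i) (d i)) T r 2 one_lt_two (fun i _ => (hr i).le) (L / 20)
    (fun i _ => (hrs i).le) (fun i hi => Set.nonempty_Icc.2 (hcd i hi).le)
  have hwc : w.Countable := huc.mono (hwT.trans fun i hi => hi.1)
  have hcover : Set.Ico 0 L ⊆ ⋃ i ∈ w, closedBall (dist i (φ τ)) (40 * r i) := by
    intro ℓ hℓ
    have hdc : ContinuousOn (fun t => dist (φ t) (φ τ)) (Set.uIcc τ τ') :=
      (continuous_id.dist continuous_const).comp_continuousOn
        (hφc.mono (Set.uIcc_subset_Icc hτ hτ'))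
    obtain ⟨t, ht, htℓ⟩ := intermediate_value_uIcc hdc
      (show ℓ ∈ Set.uIcc (dist (φ τ) (φ τ)) (dist (φ τ') (φ τ)) by
        rw [dist_self, Set.uIcc_of_le dist_nonneg]
        exact ⟨hℓ.1, hℓ.2.le.trans hLd⟩)
    dsimp only at htℓ
    have ht01 := Set.uIcc_subset_Icc hτ hτ' ht
    have hφt : φ t ∈ closedBall (0 : EuclideanSpace ℝ (Fin n)) (R + L) := by
      rw [mem_closedBall, dist_zero_right]
      have h1 : ‖φ t‖ ≤ ‖φ τ‖ + dist (φ t) (φ τ) := by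
        rw [dist_eq_norm]; exact norm_le_norm_add_norm_sub' _ _
      have h2 : ‖φ τ‖ ≤ R := hR
      linarith [hℓ.2]
    obtain ⟨i, hi, hsub⟩ := hucov _ hφt
    have hti : dist (φ t) i ≤ 5 * r i := hsub (mem_closedBall_self (hr _).le)
    have hiT : i ∈ T := ⟨hi, t, ht01, hti⟩
    obtain ⟨j, hj, ⟨s, hsi, hsj⟩, hij⟩ := hwcov i hiT
    have h1 := hball i hiT s hsi
    have h2 := hball j (hwT hj) s hsj
    refine Set.mem_iUnion₂.2 ⟨j, hj, ?_⟩
    rw [mem_closedBall, Real.dist_eq, ← htℓ]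
    refine (abs_dist_sub_le _ _ _).trans ?_
    have h3 := dist_triangle4_left (φ t) j i (φ s)
    have h3' := dist_triangle4 (φ t) i (φ s) j
    rw [dist_comm i (φ s)] at h3'
    linarith
  have hsum : ∀ i ∈ w, ENNReal.ofReal (r i) ≤
      ENNReal.ofReal ‖v‖ * ∫⁻ t in Set.Icc (c i) (d i), σ (x + t • v) := by
    intro i hi
    have hρm : Measurable fun t : ℝ => ρ i (x + t • v) := (hρ i).1.comp hγ.measurable
    calc ENNReal.ofReal (r i) ≤ ENNReal.ofReal (r i) *
          (ENNReal.ofReal ‖v‖ * ∫⁻ t in Set.Icc (c i) (d i), ρ i (x + t • v)) :=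
          le_mul_of_one_le_right' (hone i (hwT hi))
      _ = ENNReal.ofReal ‖v‖ *
          ∫⁻ t in Set.Icc (c i) (d i), ENNReal.ofReal (r i) * ρ i (x + t • v) := by
          rw [lintegral_const_mul _ hρm]; ring
      _ ≤ _ := by
          gcongr with t
          exact le_iSup (fun i : u => ENNReal.ofReal (r i) * ρ i (x + t • v)) ⟨i, (hwT hi).1⟩
  calc ENNReal.ofReal L = volume (Set.Ico 0 L) := by rw [Real.volume_Ico, sub_zero]
    _ ≤ volume (⋃ i ∈ w, closedBall (dist i (φ τ)) (40 * r i)) := measure_mono hcover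
    _ ≤ ∑' i : w, volume (closedBall (dist (i : EuclideanSpace ℝ (Fin n)) (φ τ)) (40 * r i)) :=
        measure_biUnion_le volume hwc _
    _ ≤ ∑' i : w, 80 * (ENNReal.ofReal ‖v‖ *
          ∫⁻ t in Set.Icc (c i) (d i), σ (x + t • v)) := by
        refine ENNReal.tsum_le_tsum fun i => ?_
        rw [Real.volume_closedBall, ← mul_assoc, ENNReal.ofReal_mul (by norm_num),
          show ENNReal.ofReal (2 * 40) = 80 by norm_num]
        exact mul_le_mul_right (hsum i i.2) _
    _ = 80 * (ENNReal.ofReal ‖v‖ * ∑' i : w,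
          ∫⁻ t in Set.Icc (c i) (d i), σ (x + t • v)) := by
        rw [ENNReal.tsum_mul_left, ENNReal.tsum_mul_left]
    _ = 80 * (ENNReal.ofReal ‖v‖ *
          ∫⁻ t in ⋃ i ∈ w, Set.Icc (c i) (d i), σ (x + t • v)) := by
        rw [lintegral_biUnion hwc (fun i _ => measurableSet_Icc) hwdisj]
    _ ≤ 80 * (ENNReal.ofReal ‖v‖ * ∫⁻ t in Set.Icc (0 : ℝ) 1, σ (x + t • v)) := by
        gcongr
        exact Set.iUnion₂_subset fun i hi =>
            Set.Icc_subset_Icc (hc i (hwT hi)) (hd i (hwT hi))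

lemma lintegral_comp_add_smul {m : ℕ} {H : (Fin m → ℝ) → ℝ≥0∞} (hH : Measurable H)
    (c : Fin m → ℝ) {t : ℝ} (ht : 0 < t) :
    ∫⁻ z, H (c + t • z) = ENNReal.ofReal ((t ^ m)⁻¹) * ∫⁻ z, H z := by
  have hm : Measurable fun z => H (c + z) := hH.comp (measurable_const_add c)
  have h := lintegral_map (μ := volume) hm (measurable_const_smul t)
  rw [Measure.map_addHaar_smul volume ht.ne', lintegral_smul_measure, Module.finrank_fin_fun,
    abs_of_pos (by positivity), lintegral_add_left_eq_self] at h
  exact h.symm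

lemma lintegral_Ioc_rpow {α : ℝ} (hα : -1 < α) :
    ∫⁻ t in Set.Ioc (0 : ℝ) 1, ENNReal.ofReal (t ^ α) = ENNReal.ofReal (1 / (α + 1)) := by
  have hint := (intervalIntegral.intervalIntegrable_rpow' (a := 0) (b := 1) hα)
  rw [intervalIntegrable_iff_integrableOn_Ioc_of_le zero_le_one] at hint
  rw [← ofReal_integral_eq_lintegral_ofReal hint
    ((ae_restrict_iff' measurableSet_Ioc).2 (ae_of_all _ fun t ht => Real.rpow_nonneg ht.1.le _)),
    ← intervalIntegral.integral_of_le zero_le_one, integral_rpow (Or.inl hα)]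
  simp [Real.zero_rpow (by linarith : α + 1 ≠ 0)]

lemma le_add_pow_mul (g : ℝ≥0∞) (m : ℕ) {l : ℝ} (hl : 0 < l) :
    g ≤ ENNReal.ofReal l + ENNReal.ofReal ((l ^ m)⁻¹) * g ^ (m + 1) := by
  rcases le_total g (ENNReal.ofReal l) with h | h
  · exact h.trans le_self_add
  · refine le_trans ?_ le_add_self
    have h1 : (1 : ℝ≥0∞) ≤ ENNReal.ofReal ((l ^ m)⁻¹) * g ^ m := by
      calc (1 : ℝ≥0∞) = ENNReal.ofReal ((l ^ m)⁻¹) * ENNReal.ofReal l ^ m := by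
            rw [← ENNReal.ofReal_pow hl.le, ← ENNReal.ofReal_mul (by positivity),
              inv_mul_cancel₀ (by positivity), ENNReal.ofReal_one]
        _ ≤ _ := by gcongr
    calc g = 1 * g := (one_mul g).symm
      _ ≤ ENNReal.ofReal ((l ^ m)⁻¹) * g ^ m * g := by gcongr
      _ = _ := by rw [pow_succ, mul_assoc]

/-- The average over the cube of the integrals of `G` along the segments issuing from a point is
controlled by the `L^{m+1}` mass of `G` (a Morrey-type estimate). -/
lemma lintegral_cube_segment_le {m : ℕ} {G : (Fin m → ℝ) → ℝ≥0∞} (hG : Measurable G)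
    {P : Fin m → ℝ} (hP : P ∈ Set.Icc (-1 : Fin m → ℝ) 1) {l : ℝ} (hl : 0 < l) :
    ∫⁻ z in Set.Icc (-1 : Fin m → ℝ) 1, ∫⁻ t in Set.Icc (0 : ℝ) 1, G (P + t • (z - P)) ≤
      (m + 1) * (ENNReal.ofReal l * volume (Set.Icc (-1 : Fin m → ℝ) 1) +
        ENNReal.ofReal ((l ^ m)⁻¹) * ∫⁻ z in Set.Icc (-1 : Fin m → ℝ) 1, G z ^ (m + 1)) := by
  set C := Set.Icc (-1 : Fin m → ℝ) 1 with hC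
  set α : ℝ := -(m / (m + 1) : ℝ) with hα
  have hα1 : α + 1 = 1 / (m + 1) := by rw [hα]; field_simp; ring
  have hα0 : -1 < α := by
    have : (0 : ℝ) < 1 / (m + 1) := by positivity
    linarith
  have hCm : MeasurableSet C := measurableSet_Icc
  have hmeas : Measurable fun p : (Fin m → ℝ) × ℝ => G (P + p.2 • (p.1 - P)) := by
    refine hG.comp ?_
    fun_prop
  have hslice : ∀ t ∈ Set.Ioc (0 : ℝ) 1, ∫⁻ z in C, G (P + t • (z - P)) ≤
      ENNReal.ofReal (t ^ α) * (ENNReal.ofReal l * volume C +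
        ENNReal.ofReal ((l ^ m)⁻¹) * ∫⁻ z in C, G z ^ (m + 1)) := by
    intro t ht
    have ht0 : 0 < t := ht.1
    have htα : 0 < t ^ α := Real.rpow_pos_of_pos ht0 _
    have hGt : Measurable fun z => G (P + t • (z - P)) := hG.comp (by fun_prop)
    have hexp : ((l * t ^ α) ^ m)⁻¹ * (t ^ m)⁻¹ = t ^ α * (l ^ m)⁻¹ := by
      have : (t ^ α) ^ m * t ^ m * t ^ α = 1 := by
        rw [← Real.rpow_natCast (t ^ α), ← Real.rpow_mul ht0.le, ← Real.rpow_natCast t,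
          ← Real.rpow_add ht0, ← Real.rpow_add ht0]
        rw [show α * m + m + α = 0 by
          rw [hα]; field_simp; ring, Real.rpow_zero]
      rw [mul_pow]
      field_simp
      linarith
    have hcv : ∫⁻ z in C, G (P + t • (z - P)) ^ (m + 1) ≤
        ENNReal.ofReal ((t ^ m)⁻¹) * ∫⁻ z in C, G z ^ (m + 1) := by
      rw [← lintegral_indicator hCm (fun z => G z ^ (m + 1)),
        ← lintegral_comp_add_smul ((hG.pow_const _).indicator hCm) (P - t • P) ht0,
        ← lintegral_indicator hCm]
      refine lintegral_mono fun z => ?_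
      by_cases hz : z ∈ C
      · have hmem : P - t • P + t • z ∈ C := by
          have := (convex_Icc (-1 : Fin m → ℝ) 1) hP hz (sub_nonneg.2 ht.2) ht0.le (by ring)
          rwa [sub_smul, one_smul] at this
        rw [Set.indicator_of_mem hz, Set.indicator_of_mem hmem]
        rw [smul_sub, ← add_sub_assoc, add_sub_right_comm]
      · rw [Set.indicator_of_notMem hz]
        exact zero_le
    calc ∫⁻ z in C, G (P + t • (z - P))
        ≤ ∫⁻ z in C, (ENNReal.ofReal (l * t ^ α) +
            ENNReal.ofReal (((l * t ^ α) ^ m)⁻¹) * G (P + t • (z - P)) ^ (m + 1)) :=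
          lintegral_mono fun z => le_add_pow_mul _ m (by positivity)
      _ = ENNReal.ofReal (l * t ^ α) * volume C + ENNReal.ofReal (((l * t ^ α) ^ m)⁻¹) *
            ∫⁻ z in C, G (P + t • (z - P)) ^ (m + 1) := by
          rw [lintegral_add_left measurable_const, lintegral_const_mul _ (hGt.pow_const _),
            setLIntegral_const]
      _ ≤ ENNReal.ofReal (l * t ^ α) * volume C + ENNReal.ofReal (((l * t ^ α) ^ m)⁻¹) *
            (ENNReal.ofReal ((t ^ m)⁻¹) * ∫⁻ z in C, G z ^ (m + 1)) := by gcongr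
      _ = _ := by
          rw [← mul_assoc, ← ENNReal.ofReal_mul (by positivity), hexp,
            ENNReal.ofReal_mul htα.le, mul_comm l, ENNReal.ofReal_mul htα.le]
          ring
  rw [← restrict_Ioc_eq_restrict_Icc (μ := (volume : Measure ℝ)), lintegral_lintegral_swap hmeas.aemeasurable]
  calc ∫⁻ t in Set.Ioc (0 : ℝ) 1, ∫⁻ z in C, G (P + t • (z - P))
      ≤ ∫⁻ t in Set.Ioc (0 : ℝ) 1, ENNReal.ofReal (t ^ α) * (ENNReal.ofReal l * volume C +
        ENNReal.ofReal ((l ^ m)⁻¹) * ∫⁻ z in C, G z ^ (m + 1)) :=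
        setLIntegral_mono' measurableSet_Ioc hslice
    _ = _ := by
        rw [lintegral_mul_const _ (by fun_prop), lintegral_Ioc_rpow hα0, hα1, one_div_one_div]
        congr 1
        rw [ENNReal.ofReal_add (by positivity) zero_le_one]
        simp

/-- If `G` has small `L^{m+1}` mass on the cube, any two points of the cube can be joined, through
a third one, by segments along which `G` has small integral. -/
lemma exists_cube_point {m : ℕ} {κ : ℝ} (hκ : 0 < κ) :
    ∃ c : ℝ, 0 < c ∧ ∀ G : (Fin m → ℝ) → ℝ≥0∞, Measurable G →
      ∫⁻ z in Set.Icc (-1 : Fin m → ℝ) 1, G z ^ (m + 1) < ENNReal.ofReal c →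
      ∀ P ∈ Set.Icc (-1 : Fin m → ℝ) 1, ∀ P' ∈ Set.Icc (-1 : Fin m → ℝ) 1,
      ∃ Z ∈ Set.Icc (-1 : Fin m → ℝ) 1,
        ∫⁻ t in Set.Icc (0 : ℝ) 1, G (P + t • (Z - P)) < ENNReal.ofReal κ ∧
        ∫⁻ t in Set.Icc (0 : ℝ) 1, G (P' + t • (Z - P')) < ENNReal.ofReal κ := by
  have hvol : volume (Set.Icc (-1 : Fin m → ℝ) 1) = ENNReal.ofReal (2 ^ m) := by
    rw [Real.volume_Icc_pi]
    simp
    norm_num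
  set l : ℝ := κ / (4 * (m + 1)) with hl
  have hl0 : 0 < l := by positivity
  refine ⟨κ * 2 ^ m * l ^ m / (4 * (m + 1)), by positivity, fun G hG hW P hP P' hP' => ?_⟩
  by_contra! hcon
  set C := Set.Icc (-1 : Fin m → ℝ) 1 with hC
  set A : (Fin m → ℝ) → (Fin m → ℝ) → ℝ≥0∞ := fun P z =>
    ∫⁻ t in Set.Icc (0 : ℝ) 1, G (P + t • (z - P)) with hA
  have hAm : ∀ P, Measurable (A P) := fun P => by
    refine Measurable.lintegral_prod_right' (f := fun p : (Fin m → ℝ) × ℝ =>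
      G (P + p.2 • (p.1 - P))) (hG.comp ?_)
    fun_prop
  have hlow : ∀ z ∈ C, ENNReal.ofReal κ ≤ A P z + A P' z := by
    intro z hz
    by_cases h : A P z < ENNReal.ofReal κ
    · exact (hcon z hz h).trans le_add_self
    · exact (not_lt.1 h).trans le_self_add
  have hup : ∀ P ∈ C, ∫⁻ z in C, A P z < ENNReal.ofReal (κ * 2 ^ m / 2) := by
    intro P hP
    refine (lintegral_cube_segment_le hG hP hl0).trans_lt ?_
    rw [hvol, ← ENNReal.ofReal_mul hl0.le]
    calc _ < (m + 1 : ℝ≥0∞) * (ENNReal.ofReal (l * 2 ^ m) + ENNReal.ofReal ((l ^ m)⁻¹) *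
          ENNReal.ofReal (κ * 2 ^ m * l ^ m / (4 * (m + 1)))) := by
          have h0 : (m + 1 : ℝ≥0∞) ≠ 0 := by positivity
          have ht : (m + 1 : ℝ≥0∞) ≠ ∞ := by finiteness
          rw [ENNReal.mul_lt_mul_iff_right h0 ht]
          refine (ENNReal.add_lt_add_iff_left ENNReal.ofReal_ne_top).2 ?_
          exact (ENNReal.mul_lt_mul_iff_right (ENNReal.ofReal_pos.2 (by positivity)).ne'
            ENNReal.ofReal_ne_top).2 hW
      _ = ENNReal.ofReal ((m + 1) * (l * 2 ^ m + (l ^ m)⁻¹ *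
          (κ * 2 ^ m * l ^ m / (4 * (m + 1))))) := by
          rw [ENNReal.ofReal_mul (p := (m + 1 : ℝ)) (by positivity),
            ENNReal.ofReal_add (p := l * 2 ^ m) (by positivity) (by positivity),
            ENNReal.ofReal_mul (p := (l ^ m)⁻¹) (by positivity),
            ENNReal.ofReal_add (p := (m : ℝ)) (by positivity) zero_le_one]
          simp
      _ = _ := by
          congr 1
          have : (l ^ m)⁻¹ * (κ * 2 ^ m * l ^ m / (4 * (m + 1))) = κ * 2 ^ m / (4 * (m + 1)) := by
            field_simp
          rw [this, hl]
          field_simp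
          norm_num
  have hbad : ENNReal.ofReal κ * ENNReal.ofReal (2 ^ m) < ENNReal.ofReal (κ * 2 ^ m) := by
    calc ENNReal.ofReal κ * ENNReal.ofReal (2 ^ m) = ∫⁻ _ in C, ENNReal.ofReal κ := by
          rw [setLIntegral_const, hvol]
      _ ≤ ∫⁻ z in C, (A P z + A P' z) := setLIntegral_mono' measurableSet_Icc hlow
      _ = (∫⁻ z in C, A P z) + ∫⁻ z in C, A P' z := lintegral_add_left (hAm P) _
      _ < ENNReal.ofReal (κ * 2 ^ m / 2) + ENNReal.ofReal (κ * 2 ^ m / 2) :=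
          ENNReal.add_lt_add (hup P hP) (hup P' hP')
      _ = _ := by
          rw [← ENNReal.ofReal_add (by positivity) (by positivity), add_halves]
  rw [ENNReal.ofReal_mul hκ.le] at hbad
  exact lt_irrefl _ hbad

section Topology

variable {X F : Type*} [TopologicalSpace X] [NormedAddCommGroup F] [NormedSpace ℝ F]

/-- If the image of an open set meets a ball but misses one of its points, then the ball contains
the image of a boundary point. -/
lemma exists_boundary_mem_ball {f : X → F} {U K : Set X} (hK : IsCompact K)
    (hfK : ContinuousOn f K) (hfU : IsOpen (f '' U)) (hUK : U ⊆ K) {a : F} {R : ℝ}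
    (ha : a ∈ ball (0 : F) R) (haU : a ∉ f '' U) {x : X} (hx : x ∈ U) (hxR : f x ∈ ball (0 : F) R) :
    ∃ p ∈ K \ U, f p ∈ ball (0 : F) R := by
  by_contra! h
  refine haU ((IsPreconnected.subset_left_of_subset_union hfU
    (hK.image_of_continuousOn hfK).isClosed.isOpen_compl ?_ ?_ ⟨f x, hxR, mem_image_of_mem f hx⟩
    (convex_ball (0 : F) R).isPreconnected) ha)
  · exact disjoint_compl_right.mono_left (image_mono hUK)
  · intro y hy
    by_cases hyK : y ∈ f '' K
    · obtain ⟨z, hz, rfl⟩ := hyK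
      by_cases hzU : z ∈ U
      · exact Or.inl (mem_image_of_mem f hzU)
      · exact absurd hy (h z ⟨hz, hzU⟩)
    · exact Or.inr hyK

/-- Maximum principle for the distance to a point under an open map. -/
lemma dist_lt_of_boundary_dist_lt {f : X → F} {U K : Set X} (hK : IsCompact K)
    (hfK : ContinuousOn f K) (hfU : IsOpen (f '' U)) (hUK : U ⊆ K) {e : ℝ} (he : 0 < e) {b : F}
    (hb : ∀ q ∈ K \ U, dist (f q) b < e) {x : X} (hx : x ∈ K) : dist (f x) b < e := by
  obtain ⟨z, hz, hmax⟩ := hK.exists_isMaxOn ⟨x, hx⟩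
    ((continuous_id.dist continuous_const : Continuous fun y : F => dist y b).comp_continuousOn hfK)
  refine (hmax hx).trans_lt ?_
  by_cases hzU : z ∈ U
  · by_contra! hle
    have hne : dist (f z) b ≠ 0 := (he.trans_le hle).ne'
    have := interior_maximal (s := closedBall b (dist (f z) b))
      (image_subset_iff.2 fun w hw => hmax (hUK hw)) hfU (mem_image_of_mem f hzU)
    rw [interior_closedBall _ hne] at this
    exact lt_irrefl _ (mem_ball.1 this)
  · exact hb z ⟨hz, hzU⟩

end Topology

/-- If `g` satisfies a length-energy inequality with density `S` and the energy of `S` on a face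
of a cube is small, then `g` has small oscillation on the face. -/
lemma exists_dist_lt_of_face_energy_lt {F : Type*} [SeminormedAddCommGroup F] (m : ℕ) {B L : ℝ}
    (hB : 0 ≤ B) (hL : 0 < L) :
    ∃ c : ℝ, 0 < c ∧ ∀ (g : (Fin (m + 1) → ℝ) → F) (S : (Fin (m + 1) → ℝ) → ℝ≥0∞) (δ R : ℝ),
      Measurable S →
      (∀ x ∈ closedBall 0 δ, ∀ y ∈ closedBall 0 δ, (‖g x‖ ≤ R ∨ ‖g y‖ ≤ R) →
        L ≤ dist (g x) (g y) → ENNReal.ofReal L ≤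
          ENNReal.ofReal (B * ‖y - x‖) * ∫⁻ t in Set.Icc (0 : ℝ) 1, S (x + t • (y - x))) →
      ∀ r : ℝ, 0 < r → r ≤ δ → ∀ (i : Fin (m + 1)) (s : ℝ), |s| = r →
      ∫⁻ w in Set.Icc (-1 : Fin m → ℝ) 1,
        (ENNReal.ofReal r * S (i.insertNth s (r • w))) ^ (m + 1) < ENNReal.ofReal c →
      ∀ x y : Fin (m + 1) → ℝ, ‖x‖ ≤ r → ‖y‖ ≤ r → x i = s → y i = s → ‖g x‖ + L ≤ R →
        dist (g x) (g y) < 2 * L := by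
  set κ : ℝ := L / (2 * B + 1) with hκ
  have hκ0 : 0 < κ := by positivity
  have hκL : 2 * B * κ < L := by
    have : κ * (2 * B + 1) = L := by rw [hκ]; field_simp
    nlinarith
  obtain ⟨c, hc, hcube⟩ := exists_cube_point (m := m) hκ0
  refine ⟨c, hc, fun g S δ R hS hE r hr hrδ i s hs hsmall x y hx hy hxi hyi hR => ?_⟩
  set G : (Fin m → ℝ) → ℝ≥0∞ := fun w => ENNReal.ofReal r * S (i.insertNth s (r • w)) with hG
  have hins : Measurable fun w : Fin m → ℝ => (i.insertNth s (r • w) : Fin (m + 1) → ℝ) := by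
    refine measurable_pi_iff.2 ((Fin.forall_iff_succAbove i).2 ⟨by simp, fun j => ?_⟩)
    simp only [Fin.insertNth_apply_succAbove]
    fun_prop
  have hGm : Measurable G := (hS.comp hins).const_mul _
  have hparam : ∀ z : Fin (m + 1) → ℝ, ‖z‖ ≤ r → z i = s →
      ∃ w ∈ Set.Icc (-1 : Fin m → ℝ) 1, (i.insertNth s (r • w) : Fin (m + 1) → ℝ) = z := by
    intro z hz hzi
    have hz' : ∀ j, |z j| ≤ r := fun j => (norm_le_pi_norm z j).trans hz
    refine ⟨fun j => r⁻¹ * z (i.succAbove j), ⟨fun j => ?_, fun j => ?_⟩, ?_⟩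
    · have := (abs_le.1 (hz' (i.succAbove j))).1
      simp only [Pi.neg_apply, Pi.one_apply]
      rw [inv_mul_eq_div, le_div_iff₀ hr]
      linarith
    · have := (abs_le.1 (hz' (i.succAbove j))).2
      simp only [Pi.one_apply]
      rw [inv_mul_eq_div, div_le_iff₀ hr]
      linarith
    · refine Fin.insertNth_eq_iff.2 ⟨hzi.symm, ?_⟩
      funext j
      simp [Fin.removeNth, hr.ne']
  have hnorm : ∀ w ∈ Set.Icc (-1 : Fin m → ℝ) 1,
      ‖(i.insertNth s (r • w) : Fin (m + 1) → ℝ)‖ ≤ r := by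
    intro w hw
    refine (pi_norm_le_iff_of_nonneg hr.le).2 ((Fin.forall_iff_succAbove i).2 ⟨?_, fun j => ?_⟩)
    · simp [hs]
    · simp only [Fin.insertNth_apply_succAbove, Pi.smul_apply, smul_eq_mul, Real.norm_eq_abs,
        abs_mul, abs_of_pos hr]
      have : |w j| ≤ 1 := abs_le.2 ⟨hw.1 j, hw.2 j⟩
      nlinarith
  have hseg : ∀ P ∈ Set.Icc (-1 : Fin m → ℝ) 1, ∀ Z ∈ Set.Icc (-1 : Fin m → ℝ) 1,
      ∫⁻ t in Set.Icc (0 : ℝ) 1, G (P + t • (Z - P)) < ENNReal.ofReal κ →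
      (‖g (i.insertNth s (r • P))‖ ≤ R ∨ ‖g (i.insertNth s (r • Z))‖ ≤ R) →
      dist (g (i.insertNth s (r • P))) (g (i.insertNth s (r • Z))) < L := by
    intro P hP Z hZ hlt hle
    by_contra! hdist
    have h1 := hE _ (mem_closedBall_zero_iff.2 ((hnorm P hP).trans hrδ)) _
      (mem_closedBall_zero_iff.2 ((hnorm Z hZ).trans hrδ)) hle hdist
    refine absurd h1 (not_le.2 ?_)
    have hdiff : ‖(i.insertNth s (r • Z) - i.insertNth s (r • P) : Fin (m + 1) → ℝ)‖ ≤ 2 * r := by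
      have := norm_sub_le (i.insertNth s (r • Z) : Fin (m + 1) → ℝ) (i.insertNth s (r • P))
      linarith [hnorm P hP, hnorm Z hZ]
    have hpt : ∀ t : ℝ, (i.insertNth s (r • P) +
        t • (i.insertNth s (r • Z) - i.insertNth s (r • P)) : Fin (m + 1) → ℝ) =
        i.insertNth s (r • (P + t • (Z - P))) := by
      intro t
      refine funext ((Fin.forall_iff_succAbove i).2 ⟨by simp, fun j => ?_⟩)
      simp
      ring
    simp only [hpt]
    calc ENNReal.ofReal (B * ‖(i.insertNth s (r • Z) - i.insertNth s (r • P) : Fin (m + 1) → ℝ)‖) *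
          ∫⁻ t in Set.Icc (0 : ℝ) 1, S (i.insertNth s (r • (P + t • (Z - P))))
        ≤ ENNReal.ofReal (2 * B * r) *
          ∫⁻ t in Set.Icc (0 : ℝ) 1, S (i.insertNth s (r • (P + t • (Z - P)))) := by
          refine mul_le_mul' (ENNReal.ofReal_le_ofReal ?_) le_rfl
          nlinarith
      _ = ENNReal.ofReal (2 * B) * ∫⁻ t in Set.Icc (0 : ℝ) 1, G (P + t • (Z - P)) := by
          rw [hG, lintegral_const_mul' _ _ ENNReal.ofReal_ne_top,
            ENNReal.ofReal_mul (by positivity), mul_assoc]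
      _ ≤ ENNReal.ofReal (2 * B) * ENNReal.ofReal κ := by gcongr
      _ < ENNReal.ofReal L := by
          rw [← ENNReal.ofReal_mul (by positivity)]
          exact (ENNReal.ofReal_lt_ofReal_iff hL).2 hκL
  obtain ⟨P, hP, rfl⟩ := hparam x hx hxi
  obtain ⟨P', hP', rfl⟩ := hparam y hy hyi
  obtain ⟨Z, hZ, h1, h2⟩ := hcube G hGm hsmall P hP P' hP'
  have d1 := hseg P hP Z hZ h1 (Or.inl (by linarith))
  have hZR : ‖g (i.insertNth s (r • Z))‖ ≤ R := by
    have := norm_le_norm_add_norm_sub' (g (i.insertNth s (r • Z))) (g (i.insertNth s (r • P)))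
    rw [← dist_eq_norm, dist_comm] at this
    linarith
  have d2 := hseg P' hP' Z hZ h2 (Or.inr hZR)
  have := dist_triangle_right (g (i.insertNth s (r • P))) (g (i.insertNth s (r • P')))
    (g (i.insertNth s (r • Z)))
  linarith

/-- Small oscillation on every face gives small oscillation on the boundary of the cube. -/
lemma dist_lt_of_faces {F : Type*} [SeminormedAddCommGroup F] {m : ℕ} (hm : m ≠ 0)
    {g : (Fin (m + 1) → ℝ) → F} {r L R : ℝ} (hr : 0 < r) (hL : 0 ≤ L)
    (hface : ∀ (i : Fin (m + 1)) (s : ℝ), |s| = r → ∀ x y : Fin (m + 1) → ℝ, ‖x‖ ≤ r → ‖y‖ ≤ r →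
      x i = s → y i = s → ‖g x‖ + L ≤ R → dist (g x) (g y) < 2 * L)
    {p q : Fin (m + 1) → ℝ} (hp : ‖p‖ = r) (hq : ‖q‖ = r) (hpR : ‖g p‖ + 5 * L ≤ R) :
    dist (g p) (g q) < 6 * L := by
  have hcoord : ∀ x : Fin (m + 1) → ℝ, ‖x‖ = r → ∃ i, |x i| = r := by
    intro x hx
    obtain ⟨i, hi⟩ := Finite.exists_max fun i => |x i|
    refine ⟨i, le_antisymm (hx ▸ norm_le_pi_norm x i) ?_⟩
    rw [← hx]
    exact (pi_norm_le_iff_of_nonneg (abs_nonneg _)).2 hi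
  have hup : ∀ {x : Fin (m + 1) → ℝ} {i : Fin (m + 1)} {s : ℝ}, ‖x‖ ≤ r → |s| = r →
      ‖Function.update x i s‖ ≤ r := by
    intro x i s hx hs
    refine (pi_norm_le_iff_of_nonneg hr.le).2 fun j => ?_
    rcases eq_or_ne j i with rfl | hji
    · simp [hs]
    · rw [Function.update_of_ne hji]
      exact (norm_le_pi_norm x j).trans hx
  have hnorm : ∀ x y, dist (g x) (g y) < 2 * L → ‖g y‖ ≤ ‖g x‖ + 2 * L := by
    intro x y h
    have := norm_le_norm_add_norm_sub' (g y) (g x)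
    rw [← dist_eq_norm, dist_comm] at this
    linarith
  obtain ⟨i, hi⟩ := hcoord p hp
  obtain ⟨j, hj⟩ := hcoord q hq
  have : Nontrivial (Fin (m + 1)) := Fin.nontrivial_iff_two_le.2 (by omega)
  have hstep : ∀ k, k ≠ i → ∀ s, |s| = r → ∀ y : Fin (m + 1) → ℝ, ‖y‖ ≤ r → y k = s →
      dist (g p) (g y) < 4 * L := by
    intro k hk s hs y hy hyk
    have h1 := hface i _ hi p (Function.update p k s) hp.le (hup hp.le hs) rfl
      (Function.update_of_ne hk.symm _ _) (by linarith)
    have h2 := hface k s hs (Function.update p k s) y (hup hp.le hs) hy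
      (Function.update_self _ _ _) hyk (by linarith [hnorm _ _ h1])
    linarith [dist_triangle (g p) (g (Function.update p k s)) (g y)]
  obtain ⟨k, hk⟩ := exists_ne j
  by_cases hji : j = i
  · subst hji
    have h1 := hstep k hk r (abs_of_pos hr) (Function.update q k r)
      (hup hq.le (abs_of_pos hr)) (Function.update_self _ _ _)
    have h3 : ‖g (Function.update q k r)‖ ≤ ‖g p‖ + 4 * L := by
      have := norm_le_norm_add_norm_sub' (g (Function.update q k r)) (g p)
      rw [← dist_eq_norm, dist_comm] at this
      linarith
    have h2 := hface j _ hj (Function.update q k r) q (hup hq.le (abs_of_pos hr)) hq.le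
      (Function.update_of_ne hk.symm _ _) rfl (by linarith)
    linarith [dist_triangle (g p) (g (Function.update q k r)) (g q)]
  · linarith [hstep j hji _ hj q hq.le rfl, dist_nonneg (x := g p) (y := g q)]

/-- Fubini's theorem for the coordinate hyperplanes. -/
lemma lintegral_insertNth {m : ℕ} {H : (Fin (m + 1) → ℝ) → ℝ≥0∞} (hH : Measurable H)
    (i : Fin (m + 1)) : ∫⁻ r : ℝ, ∫⁻ w : Fin m → ℝ, H (i.insertNth r w) = ∫⁻ x, H x := by
  have hmp := (volume_preserving_piFinSuccAbove (fun _ : Fin (m + 1) => ℝ) i).symm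
  rw [← hmp.lintegral_comp_emb (MeasurableEquiv.measurableEmbedding _)]
  have hm : Measurable fun p : ℝ × (Fin m → ℝ) => H (i.insertNth p.1 p.2) :=
    hH.comp (MeasurableEquiv.piFinSuccAbove (fun _ : Fin (m + 1) => ℝ) i).symm.measurable
  exact (lintegral_prod _ hm.aemeasurable).symm

lemma measurable_lintegral_insertNth {m : ℕ} {H : (Fin (m + 1) → ℝ) → ℝ≥0∞} (hH : Measurable H)
    (i : Fin (m + 1)) : Measurable fun r : ℝ => ∫⁻ w : Fin m → ℝ, H (i.insertNth r w) := by
  have h := hH.comp (MeasurableEquiv.piFinSuccAbove (fun _ : Fin (m + 1) => ℝ) i).symm.measurable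
  exact h.lintegral_prod_right'

/-- If every cube boundary carries a definite amount of energy, the radii satisfy a logarithmic
estimate. -/
lemma mul_log_le_lintegral {m : ℕ} {S : (Fin (m + 1) → ℝ) → ℝ≥0∞} (hS : Measurable S)
    {c δ δ₁ : ℝ} (hc : 0 ≤ c) (hδ : 0 < δ) (hδ₁ : δ ≤ δ₁)
    (hface : ∀ r : ℝ, δ < r → r ≤ δ₁ → ∃ (i : Fin (m + 1)) (s : ℝ), |s| = r ∧
      ENNReal.ofReal c ≤ ∫⁻ w in Set.Icc (-1 : Fin m → ℝ) 1,
        (ENNReal.ofReal r * S (i.insertNth s (r • w))) ^ (m + 1)) :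
    ENNReal.ofReal (c * Real.log (δ₁ / δ)) ≤ (m + 1) * (2 * ∫⁻ x, S x ^ (m + 1)) := by
  set Φ : Fin (m + 1) → ℝ → ℝ≥0∞ := fun i s => ∫⁻ w : Fin m → ℝ, S (i.insertNth s w) ^ (m + 1)
  have hΦm : ∀ i, Measurable (Φ i) := fun i => measurable_lintegral_insertNth (hS.pow_const _) i
  have hΦ : ∀ i, ∫⁻ s, Φ i s = ∫⁻ x, S x ^ (m + 1) := fun i =>
    lintegral_insertNth (hS.pow_const _) i
  have hΦneg : ∀ i, ∫⁻ s, Φ i (-s) = ∫⁻ x, S x ^ (m + 1) := fun i => by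
    rw [lintegral_neg_eq_self (Φ i), hΦ]
  have hpt : ∀ r ∈ Set.Ioc δ δ₁, ENNReal.ofReal (c * r⁻¹) ≤ ∑ i, (Φ i r + Φ i (-r)) := by
    intro r hr
    have hr0 : 0 < r := hδ.trans hr.1
    obtain ⟨i, s, hs, hle⟩ := hface r hr.1 hr.2
    have hins : Measurable fun w : Fin m → ℝ => (i.insertNth s w : Fin (m + 1) → ℝ) := by
      refine measurable_pi_iff.2 ((Fin.forall_iff_succAbove i).2 ⟨by simp, fun j => ?_⟩)
      simp only [Fin.insertNth_apply_succAbove]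
      fun_prop
    have hcv := lintegral_comp_add_smul (H := fun w => S (i.insertNth s w) ^ (m + 1))
      ((hS.comp hins).pow_const _) 0 hr0
    simp only [zero_add] at hcv
    have h1 : ENNReal.ofReal c ≤ ENNReal.ofReal r * Φ i s := by
      refine hle.trans ((setLIntegral_le_lintegral _ _).trans ?_)
      simp only [mul_pow]
      rw [lintegral_const_mul' _ _ (ENNReal.pow_ne_top ENNReal.ofReal_ne_top), hcv,
        ← ENNReal.ofReal_pow hr0.le, ← mul_assoc, ← ENNReal.ofReal_mul (by positivity)]
      rw [pow_succ', mul_assoc, mul_inv_cancel₀ (by positivity), mul_one]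
    have h2 : ENNReal.ofReal (c * r⁻¹) ≤ Φ i s := by
      calc ENNReal.ofReal (c * r⁻¹) = ENNReal.ofReal r⁻¹ * ENNReal.ofReal c := by
            rw [mul_comm, ENNReal.ofReal_mul (by positivity)]
        _ ≤ ENNReal.ofReal r⁻¹ * (ENNReal.ofReal r * Φ i s) := by gcongr
        _ = Φ i s := by
            rw [← mul_assoc, ← ENNReal.ofReal_mul (by positivity), inv_mul_cancel₀ hr0.ne',
              ENNReal.ofReal_one, one_mul]
    refine (h2.trans ?_).trans
      (Finset.single_le_sum (f := fun i => Φ i r + Φ i (-r)) (fun _ _ => zero_le) (Finset.mem_univ i))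
    rcases eq_or_eq_neg_of_abs_eq hs with rfl | rfl
    · exact le_self_add
    · exact le_add_self
  have hint : IntervalIntegrable (fun r : ℝ => c * r⁻¹) volume δ δ₁ := by
    refine ContinuousOn.intervalIntegrable ?_
    rw [Set.uIcc_of_le hδ₁]
    exact continuousOn_const.mul (continuousOn_inv₀.mono fun r hr => (hδ.trans_le hr.1).ne')
  rw [intervalIntegrable_iff_integrableOn_Ioc_of_le hδ₁] at hint
  calc ENNReal.ofReal (c * Real.log (δ₁ / δ))
      = ∫⁻ r in Set.Ioc δ δ₁, ENNReal.ofReal (c * r⁻¹) := by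
        rw [← ofReal_integral_eq_lintegral_ofReal hint
          ((ae_restrict_iff' measurableSet_Ioc).2 (ae_of_all _ fun r hr => by
            have := hδ.trans hr.1
            show 0 ≤ c * r⁻¹
            positivity)),
          ← intervalIntegral.integral_of_le hδ₁, intervalIntegral.integral_const_mul,
          integral_inv_of_pos hδ (hδ.trans_le hδ₁)]
    _ ≤ ∫⁻ r in Set.Ioc δ δ₁, ∑ i, (Φ i r + Φ i (-r)) := setLIntegral_mono' measurableSet_Ioc hpt
    _ ≤ ∫⁻ r, ∑ i, (Φ i r + Φ i (-r)) := setLIntegral_le_lintegral _ _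
    _ = ∑ i, ∫⁻ r, (Φ i r + Φ i (-r)) :=
        lintegral_finsetSum _ fun i _ => (hΦm i).add ((hΦm i).comp measurable_neg)
    _ = ∑ _i : Fin (m + 1), 2 * ∫⁻ x, S x ^ (m + 1) :=
        Finset.sum_congr rfl fun i _ => by
          rw [lintegral_add_left (hΦm i), hΦ, hΦneg, two_mul]
    _ = _ := by simp

/-- Equicontinuity on cubes, in the Euclidean metric, of the maps into a fixed ball. -/
lemma exists_forall_dist_lt {m : ℕ} (hm : m ≠ 0) {D : Set (EuclideanSpace ℝ (Fin (m + 1)))}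
    {x₀ : EuclideanSpace ℝ (Fin (m + 1))} {δ₁ : ℝ} (hδ₁ : 0 < δ₁)
    (hD : ∀ u : Fin (m + 1) → ℝ, ‖u‖ ≤ δ₁ → x₀ + WithLp.toLp 2 u ∈ D)
    {a : EuclideanSpace ℝ (Fin (m + 1))} {Q : EuclideanSpace ℝ (Fin (m + 1)) → ℝ≥0∞}
    (hQloc : ∀ K : Set (EuclideanSpace ℝ (Fin (m + 1))), IsCompact K → (∫⁻ y in K, Q y) < ∞)
    {ε R : ℝ} (hε : 0 < ε) (haR : ‖a‖ < R) :
    ∃ δ > (0 : ℝ), ∀ f : EuclideanSpace ℝ (Fin (m + 1)) → EuclideanSpace ℝ (Fin (m + 1)),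
      ContinuousOn f D → IsOpenOn (m + 1) D f → (∀ x ∈ D, f x ≠ a) →
      (∀ y₀, InvPoletsky (m + 1) D f Q y₀) → ∀ u : Fin (m + 1) → ℝ, ‖u‖ < δ →
      (‖f (x₀ + WithLp.toLp 2 u)‖ < R ∨ ‖f x₀‖ < R) →
      dist (f (x₀ + WithLp.toLp 2 u)) (f x₀) < ε := by
  set T : (Fin (m + 1) → ℝ) →L[ℝ] EuclideanSpace ℝ (Fin (m + 1)) :=
    ((PiLp.continuousLinearEquiv 2 ℝ (fun _ : Fin (m + 1) => ℝ)).symm :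
      (Fin (m + 1) → ℝ) →L[ℝ] EuclideanSpace ℝ (Fin (m + 1))) with hT
  set h : (Fin (m + 1) → ℝ) ≃ₜ EuclideanSpace ℝ (Fin (m + 1)) :=
    (PiLp.continuousLinearEquiv 2 ℝ (fun _ : Fin (m + 1) => ℝ)).symm.toHomeomorph.trans
      (Homeomorph.addLeft x₀) with hh
  have hhT : ∀ u, h u = x₀ + T u := fun u => rfl
  have hhD : ∀ u : Fin (m + 1) → ℝ, ‖u‖ ≤ δ₁ → h u ∈ D := hD
  have hhmp : MeasurePreserving h volume volume :=
    (measurePreserving_add_left volume x₀).comp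
      (EuclideanSpace.volume_preserving_symm_measurableEquiv_toLp (Fin (m + 1))).symm
  set L : ℝ := ε / 12 with hL
  have hL0 : 0 < L := by positivity
  set R' : ℝ := R + 6 * L with hR'
  set A : ℝ≥0∞ := 2 * 10 ^ (m + 1) * ∫⁻ y in closedBall (0 : EuclideanSpace ℝ (Fin (m + 1)))
    (R' + L + L), (Q y + 1) with hA
  have hAtop : A ≠ ∞ := by
    refine ENNReal.mul_ne_top (by finiteness) ?_
    rw [lintegral_add_right _ measurable_const, setLIntegral_one]
    exact ENNReal.add_ne_top.2 ⟨(hQloc _ (isCompact_closedBall _ _)).ne,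
      (isCompact_closedBall _ _).measure_lt_top.ne⟩
  obtain ⟨c, hc, hface⟩ := exists_dist_lt_of_face_energy_lt
    (F := EuclideanSpace ℝ (Fin (m + 1))) m (B := 80 * ‖T‖) (by positivity) hL0
  have hKtop : ((m : ℝ≥0∞) + 1) * (2 * A) ≠ ∞ := by finiteness
  set K : ℝ := (((m : ℝ≥0∞) + 1) * (2 * A)).toReal with hK
  have hK0 : 0 ≤ K := ENNReal.toReal_nonneg
  set δ : ℝ := δ₁ * Real.exp (-((K + 1) / c)) with hδ
  have hδ0 : 0 < δ := by positivity
  have hδδ₁ : δ ≤ δ₁ := mul_le_of_le_one_right hδ₁.le (Real.exp_le_one_iff.2 (by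
    have : 0 ≤ (K + 1) / c := by positivity
    linarith))
  have hlog : c * Real.log (δ₁ / δ) = K + 1 := by
    have : δ₁ / δ = Real.exp ((K + 1) / c) := by
      rw [hδ, Real.exp_neg]
      field_simp
    rw [this, Real.log_exp]
    field_simp
  refine ⟨δ, hδ0, fun f hf hfo hfa hP u hu hnorm => ?_⟩
  by_contra! hdist
  obtain ⟨σ, hσm, hσA, hσ⟩ := exists_energy_density (Nat.succ_ne_zero m) hf hQloc hP R' hL0
  have hSm : Measurable fun u => σ (h u) := hσm.comp h.continuous.measurable
  have hSA : ∫⁻ u, σ (h u) ^ (m + 1) ≤ A :=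
    (hhmp.lintegral_comp (hσm.pow_const _)).trans_le hσA
  have hE : ∀ x ∈ closedBall (0 : Fin (m + 1) → ℝ) δ₁, ∀ y ∈ closedBall (0 : Fin (m + 1) → ℝ) δ₁,
      (‖f (h x)‖ ≤ R' ∨ ‖f (h y)‖ ≤ R') → L ≤ dist (f (h x)) (f (h y)) →
      ENNReal.ofReal L ≤ ENNReal.ofReal (80 * ‖T‖ * ‖y - x‖) *
        ∫⁻ t in Set.Icc (0 : ℝ) 1, σ (h (x + t • (y - x))) := by
    intro x hx y hy hxy hd
    have hpt : ∀ t : ℝ, h x + t • T (y - x) = h (x + t • (y - x)) := fun t => by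
      simp only [hhT, map_add, map_smul, add_assoc]
    have hseg : ∀ t ∈ Set.Icc (0 : ℝ) 1, h x + t • T (y - x) ∈ D := by
      intro t ht
      rw [hpt]
      refine hhD _ (mem_closedBall_zero_iff.1 ?_)
      exact (convex_closedBall (0 : Fin (m + 1) → ℝ) δ₁).add_smul_sub_mem hx hy ht
    have key := hσ (h x) (T (y - x)) hseg
    simp only [hpt] at key
    have h0 : (0 : ℝ) ∈ Set.Icc (0 : ℝ) 1 := by simp
    have h1 : (1 : ℝ) ∈ Set.Icc (0 : ℝ) 1 := by simp
    have key' : ENNReal.ofReal L ≤ 80 * (ENNReal.ofReal ‖T (y - x)‖ *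
        ∫⁻ t in Set.Icc (0 : ℝ) 1, σ (h (x + t • (y - x)))) := by
      rcases hxy with hxR | hyR
      · refine key 0 h0 1 h1 (by simpa using hxR) ?_
        rw [dist_comm]
        simpa using hd
      · exact key 1 h1 0 h0 (by simpa using hyR) (by simpa using hd)
    refine key'.trans ?_
    rw [← mul_assoc]
    refine mul_le_mul' ?_ le_rfl
    rw [mul_assoc, ENNReal.ofReal_mul (by norm_num)]
    simp only [ENNReal.ofReal_ofNat]
    gcongr
    exact T.le_opNorm _
  have hlarge := mul_log_le_lintegral hSm hc.le hδ0 hδδ₁ fun r hr hrδ₁ => by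
    by_contra! hsmall
    have hr0 : 0 < r := hδ0.trans hr
    have hosc : ∀ p q : Fin (m + 1) → ℝ, ‖p‖ = r → ‖q‖ = r → ‖f (h p)‖ + 5 * L ≤ R' →
        dist (f (h p)) (f (h q)) < 6 * L := fun p q =>
      dist_lt_of_faces hm (g := fun u => f (h u)) hr0 hL0.le
        fun i s hs => hface _ _ δ₁ R' hSm hE r hr0 hrδ₁ i s hs (hsmall i s hs)
    have hballD : ∀ v ∈ closedBall (0 : Fin (m + 1) → ℝ) r, h v ∈ D := fun v hv =>
      hhD v ((mem_closedBall_zero_iff.1 hv).trans hrδ₁)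
    have hcont : ContinuousOn (fun u => f (h u)) (closedBall 0 r) :=
      hf.comp h.continuous.continuousOn hballD
    have hopen : IsOpen ((fun u => f (h u)) '' ball 0 r) := by
      rw [← image_image f h]
      refine hfo _ (h.isOpen_image.2 isOpen_ball) ?_
      rintro _ ⟨v, hv, rfl⟩
      exact hballD v (ball_subset_closedBall hv)
    have hbd : ∀ {v : Fin (m + 1) → ℝ}, v ∈ closedBall 0 r \ ball 0 r → ‖v‖ = r := by
      intro v hv
      exact le_antisymm (mem_closedBall_zero_iff.1 hv.1)
        (not_lt.1 fun hlt => hv.2 (mem_ball_zero_iff.2 hlt))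
    have h0 : h 0 = x₀ := by simp [hhT]
    have hur : u ∈ ball (0 : Fin (m + 1) → ℝ) r := mem_ball_zero_iff.2 (hu.trans hr)
    have h0r : (0 : Fin (m + 1) → ℝ) ∈ ball 0 r := mem_ball_self hr0
    have hmem : ∃ x ∈ ball (0 : Fin (m + 1) → ℝ) r, f (h x) ∈ ball 0 R := by
      rcases hnorm with hn | hn
      · exact ⟨u, hur, mem_ball_zero_iff.2 hn⟩
      · exact ⟨0, h0r, mem_ball_zero_iff.2 (h0.symm ▸ hn)⟩
    obtain ⟨x, hx, hxR⟩ := hmem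
    obtain ⟨p, hp, hpR⟩ := exists_boundary_mem_ball (isCompact_closedBall 0 r) hcont hopen
      ball_subset_closedBall (mem_ball_zero_iff.2 haR)
      (by
        rintro ⟨v, hv, hva⟩
        exact hfa _ (hballD v (ball_subset_closedBall hv)) hva) hx hxR
    have hclose : ∀ v ∈ closedBall (0 : Fin (m + 1) → ℝ) r, dist (f (h v)) (f (h p)) < ε / 2 :=
      fun v hv => dist_lt_of_boundary_dist_lt (isCompact_closedBall 0 r) hcont hopen
        ball_subset_closedBall (half_pos hε) (fun q hq => by
          rw [dist_comm]
          refine (hosc _ _ (hbd hp) (hbd hq) ?_).trans_eq (by rw [hL]; ring)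
          have := mem_ball_zero_iff.1 hpR
          linarith) hv
    have hu2 := hclose u (ball_subset_closedBall hur)
    have h02 := hclose 0 (ball_subset_closedBall h0r)
    rw [h0] at h02
    have := dist_triangle_right (f (h u)) (f x₀) (f (h p))
    exact absurd (hdist.trans this) (by linarith)
  have hbound : ENNReal.ofReal (K + 1) ≤ ((m : ℝ≥0∞) + 1) * (2 * A) := by
    rw [← hlog]
    refine hlarge.trans ?_
    gcongr
  rw [← ENNReal.ofReal_toReal hKtop, ← hK, ENNReal.ofReal_le_ofReal_iff hK0] at hbound
  linarith

/-- Maps at positive chordal distance are at positive Euclidean distance, and not both large. -/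
lemma chordal_lt_of_dist_lt {n : ℕ} {x y : EuclideanSpace ℝ (Fin n)} {ε R : ℝ} (hε : 0 < ε)
    (hR : 2 / ε < R) (h : ‖x‖ < R ∨ ‖y‖ < R → dist x y < ε) : chordal n x y < ε := by
  have hR0 : 0 < R := (by positivity : 0 < 2 / ε).trans hR
  have hsqrt : ∀ z : EuclideanSpace ℝ (Fin n), 1 ≤ √(1 + ‖z‖ ^ 2) ∧ ‖z‖ ≤ √(1 + ‖z‖ ^ 2) :=
    fun z => ⟨Real.le_sqrt_of_sq_le (by nlinarith [sq_nonneg ‖z‖]),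
      Real.le_sqrt_of_sq_le (by linarith)⟩
  obtain ⟨hx1, hx2⟩ := hsqrt x
  obtain ⟨hy1, hy2⟩ := hsqrt y
  unfold chordal
  rw [div_lt_iff₀ (by positivity)]
  have hprod : 1 ≤ √(1 + ‖x‖ ^ 2) * √(1 + ‖y‖ ^ 2) := one_le_mul_of_one_le_of_one_le hx1 hy1
  by_cases hsmall : ‖x‖ < R ∨ ‖y‖ < R
  · nlinarith [h hsmall]
  · push Not at hsmall
    have h2 : 2 < ε * R := by rwa [div_lt_iff₀' hε] at hR
    have hd : dist x y ≤ √(1 + ‖x‖ ^ 2) + √(1 + ‖y‖ ^ 2) := by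
      rw [dist_eq_norm]
      exact (norm_sub_le _ _).trans (add_le_add hx2 hy2)
    have hX : R ≤ √(1 + ‖x‖ ^ 2) := hsmall.1.trans hx2
    have hY : R ≤ √(1 + ‖y‖ ^ 2) := hsmall.2.trans hy2
    have hXε : 2 < ε * √(1 + ‖x‖ ^ 2) := h2.trans_le (by gcongr)
    have hYε : 2 < ε * √(1 + ‖y‖ ^ 2) := h2.trans_le (by gcongr)
    nlinarith

/-- **Corollary 1 (Montel-type theorem, one omitted point, locally integrable `Q`).** -/
theorem equicontinuity_of_family_omitting_one_point_of_locInt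
    (n : ℕ) (hn : 2 ≤ n)
    (D : Set (EuclideanSpace ℝ (Fin n))) (hD : IsOpen D) (hDconn : IsConnected D)
    (a : EuclideanSpace ℝ (Fin n))
    (Q : EuclideanSpace ℝ (Fin n) → ℝ≥0∞) (hQmeas : Measurable Q)
    (hQloc : ∀ K : Set (EuclideanSpace ℝ (Fin n)), IsCompact K → (∫⁻ y in K, Q y) < ∞)
    (x₀ : EuclideanSpace ℝ (Fin n)) (hx₀ : x₀ ∈ D) :
    EquicontinuousAtPt n D
      {f | ContinuousOn f D ∧ IsOpenOn n D f ∧ IsDiscreteOn n D f ∧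
        (∀ x ∈ D, f x ≠ a) ∧ ∀ y₀, InvPoletsky n D f Q y₀} x₀ := by
  obtain ⟨m, rfl⟩ := Nat.exists_eq_succ_of_ne_zero (by omega : n ≠ 0)
  intro ε hε
  obtain ⟨ρ, hρ, hball⟩ := Metric.isOpen_iff.1 hD x₀ hx₀
  set T : (Fin (m + 1) → ℝ) →L[ℝ] EuclideanSpace ℝ (Fin (m + 1)) :=
    ((PiLp.continuousLinearEquiv 2 ℝ (fun _ : Fin (m + 1) => ℝ)).symm :
      (Fin (m + 1) → ℝ) →L[ℝ] EuclideanSpace ℝ (Fin (m + 1))) with hT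
  have hcube : ∀ u : Fin (m + 1) → ℝ, ‖u‖ ≤ ρ / (‖T‖ + 1) → x₀ + WithLp.toLp 2 u ∈ D := by
    intro u hu
    refine hball ?_
    rw [mem_ball, dist_self_add_left]
    have h1 : ‖T u‖ ≤ ‖T‖ * ‖u‖ := T.le_opNorm u
    have h2 : ‖u‖ * (‖T‖ + 1) ≤ ρ := by rwa [le_div_iff₀ (by positivity)] at hu
    have h3 : ‖T‖ * ‖u‖ < ρ := by
      rcases (norm_nonneg u).eq_or_lt with h0 | h0
      · rwa [← h0, mul_zero]
      · nlinarith
    exact h1.trans_lt h3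
  obtain ⟨δ, hδ, H⟩ := exists_forall_dist_lt (by omega : m ≠ 0)
    (by positivity : 0 < ρ / (‖T‖ + 1)) hcube (a := a) hQloc hε
    (R := max (2 / ε) ‖a‖ + 1) (by linarith [le_max_right (2 / ε) ‖a‖])
  refine ⟨δ, hδ, ?_⟩
  rintro f ⟨hf, hfo, -, hfa, hP⟩ x - hx
  refine chordal_lt_of_dist_lt hε (R := max (2 / ε) ‖a‖ + 1)
    (by linarith [le_max_left (2 / ε) ‖a‖]) fun hR => ?_
  have hux : x₀ + WithLp.toLp 2 (WithLp.ofLp (x - x₀)) = x := by simp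
  have hu : ‖WithLp.ofLp (x - x₀)‖ < δ := by
    refine lt_of_le_of_lt ?_ hx
    rw [dist_eq_norm]
    exact (pi_norm_le_iff_of_nonneg (norm_nonneg _)).2 fun j => PiLp.norm_apply_le _ _
  have := H f hf hfo hfa hP (WithLp.ofLp (x - x₀)) hu
  rw [hux] at this
  exact this hR

end
end

section
/- Let D ⊂ ℝⁿ (n ≥ 2) be a domain, Q : ℝⁿ → [0,∞] locally integrable on ℝⁿ, and let ℜ_Q(D) be a family of open discrete mappings f : D → ℝⁿ satisfying the inverse Poletsky inequality with majorant Q at every point y₀ ∈ ℝⁿ. Let x₀ ∈ D and assume there exist y₀ in the cluster set C(x₀, ℜ_Q(D)), a radius r₀ > 0, and a sequence y_m ∈ B(y₀, r₀), y_m ≠ y₀, y_m → y₀, such that for every m ∈ ℕ there exists C_m > 0 with dist(x₀, A_m) ≥ C_m, where A_m = {x ∈ D : there exists f ∈ ℜ_Q(D) with f(x) = y_m}. Then the family ℜ_Q(D) is equicontinuous (with respect to the chordal metric on the target) at x₀. -/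
open MeasureTheory Metric Set Filter Topology
open scoped ENNReal NNReal

noncomputable section
open scoped Classical

theorem Monotone.stieltjesFunction_measure_le {f g : ℝ → ℝ} (hf : Monotone f) (hg : Monotone g)
    (hfg : Monotone fun t => g t - f t) :
    hf.stieltjesFunction.measure ≤ hg.stieltjesFunction.measure := by
  have h : hg.stieltjesFunction = hf.stieltjesFunction + hfg.stieltjesFunction := by
    ext x
    simp only [StieltjesFunction.add_apply, Monotone.stieltjesFunction_eq]
    have h1 := (hf.tendsto_rightLim x).add (hfg.tendsto_rightLim x)
    refine tendsto_nhds_unique (hg.tendsto_rightLim x) (h1.congr fun t => ?_)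
    ring
  rw [h, StieltjesFunction.measure_add]
  exact Measure.le_add_right le_rfl

theorem varFun_sub_varFun {n : ℕ} {γ : ℝ → EuclideanSpace ℝ (Fin n)} {a b : ℝ} (hab : a ≤ b)
    (h : BoundedVariationOn γ (Icc a b)) {s t : ℝ} (hst : s ≤ t) :
    varFun n γ a b t - varFun n γ a b s =
      (eVariationOn γ (Icc (max a (min s b)) (max a (min t b)))).toReal := by
  have hs : a ≤ max a (min s b) := le_max_left _ _
  have hst' : max a (min s b) ≤ max a (min t b) := by gcongr
  have ht : max a (min t b) ≤ b := max_le hab (min_le_right _ _)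
  have hadd := eVariationOn.Icc_add_Icc γ (s := univ) hs hst' (mem_univ _)
  simp only [univ_inter] at hadd
  have h1 : eVariationOn γ (Icc a (max a (min s b))) ≠ ∞ :=
    h.mono (Icc_subset_Icc_right (hst'.trans ht))
  have h2 : eVariationOn γ (Icc (max a (min s b)) (max a (min t b))) ≠ ∞ :=
    h.mono (Icc_subset_Icc hs ht)
  rw [varFun, varFun, ← hadd, ENNReal.toReal_add h1 h2]
  ring

theorem varFun_monotone {n : ℕ} {γ : ℝ → EuclideanSpace ℝ (Fin n)} {a b : ℝ} (hab : a ≤ b)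
    (h : BoundedVariationOn γ (Icc a b)) : Monotone (varFun n γ a b) := fun s t hst => by
  rw [← sub_nonneg, varFun_sub_varFun hab h hst]
  positivity

theorem arcIntegral_eq {n : ℕ} (ρ : EuclideanSpace ℝ (Fin n) → ℝ≥0∞)
    {γ : ℝ → EuclideanSpace ℝ (Fin n)} {a b : ℝ} (hab : a ≤ b)
    (h : BoundedVariationOn γ (Icc a b)) :
    arcIntegral n ρ γ a b =
      ∫⁻ t in Icc a b, ρ (γ t) ∂(varFun_monotone hab h).stieltjesFunction.measure := by
  rw [arcIntegral, dif_pos ⟨h, varFun_monotone hab h⟩]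

theorem arcIntegral_le_of_lipschitzOnWith {n : ℕ} (ρ : EuclideanSpace ℝ (Fin n) → ℝ≥0∞)
    {γ : ℝ → EuclideanSpace ℝ (Fin n)} {a b : ℝ} (hab : a ≤ b) {K : ℝ≥0}
    (h : LipschitzOnWith K γ (Icc a b)) :
    arcIntegral n ρ γ a b ≤ K * ∫⁻ t in Icc a b, ρ (γ t) := by
  have key : ∀ s t, s ∈ Icc a b → t ∈ Icc a b → s ≤ t →
      eVariationOn γ (Icc s t) ≤ ENNReal.ofReal (K * (t - s)) := by
    intro s t hs ht hst
    have h1 := (h.mono (Icc_subset_Icc hs.1 ht.2)).comp_eVariationOn_le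
      (g := id) (s := Icc s t) (mapsTo_id _)
    rw [eVariationOn_id_Icc] at h1
    rw [ENNReal.ofReal_mul K.coe_nonneg, ENNReal.ofReal_coe_nnreal]
    exact h1
  have hbv : BoundedVariationOn γ (Icc a b) :=
    ne_top_of_le_ne_top ENNReal.ofReal_ne_top
      (key a b (left_mem_Icc.2 hab) (right_mem_Icc.2 hab) hab)
  rw [arcIntegral_eq ρ hab hbv]
  have hK : Monotone fun t : ℝ => (K : ℝ) * t := fun s t hst => by
    have := K.coe_nonneg
    dsimp only
    gcongr
  have hsub : Monotone fun t => (K : ℝ) * t - varFun n γ a b t := by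
    intro s t hst
    have hst' : max a (min s b) ≤ max a (min t b) := by gcongr
    have h1 := varFun_sub_varFun hab hbv hst
    have h2 := key (max a (min s b)) (max a (min t b))
      ⟨le_max_left _ _, max_le hab (min_le_right _ _)⟩
      ⟨le_max_left _ _, max_le hab (min_le_right _ _)⟩ hst'
    have h3 := ENNReal.toReal_mono ENNReal.ofReal_ne_top h2
    rw [ENNReal.toReal_ofReal (mul_nonneg K.coe_nonneg (sub_nonneg.2 hst'))] at h3
    have h4 : max a (min t b) - max a (min s b) ≤ t - s := by
      rcases max_cases a (min t b) with h | h <;> rcases max_cases a (min s b) with h' | h' <;>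
      rcases min_cases t b with h'' | h'' <;> rcases min_cases s b with h''' | h''' <;> linarith
    have h5 := mul_le_mul_of_nonneg_left h4 K.coe_nonneg
    dsimp only
    change (K : ℝ) * _ ≤ K * _ at h5
    linarith
  have hle := (varFun_monotone hab hbv).stieltjesFunction_measure_le hK hsub
  have heq : hK.stieltjesFunction = K • StieltjesFunction.id := by
    ext x
    rw [Monotone.stieltjesFunction_eq]
    exact (ContinuousAt.continuousWithinAt (by fun_prop)).rightLim_eq
  rw [heq, StieltjesFunction.measure_smul, ← Real.volume_eq_stieltjes_id] at hle
  calc _ ≤ ∫⁻ t in Icc a b, ρ (γ t) ∂(K • volume) :=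
        lintegral_mono' (Measure.restrict_mono le_rfl hle) le_rfl
    _ = _ := by
        rw [Measure.restrict_smul, lintegral_smul_measure]
        rfl

theorem arcIntegral_le_of_subinterval {n : ℕ} (ρ : EuclideanSpace ℝ (Fin n) → ℝ≥0∞)
    {γ : ℝ → EuclideanSpace ℝ (Fin n)} {a b c d : ℝ} (hac : a ≤ c) (hcd : c ≤ d) (hdb : d ≤ b)
    (h : BoundedVariationOn γ (Icc a b)) :
    arcIntegral n ρ γ c d ≤ ∫⁻ t in Icc c d, ρ (γ t)
      ∂(varFun_monotone (hac.trans (hcd.trans hdb)) h).stieltjesFunction.measure := by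
  have hab := hac.trans (hcd.trans hdb)
  have h' : BoundedVariationOn γ (Icc c d) := h.mono (Icc_subset_Icc hac hdb)
  rw [arcIntegral_eq ρ hcd h']
  refine lintegral_mono' (Measure.restrict_mono le_rfl ?_) le_rfl
  refine Monotone.stieltjesFunction_measure_le _ _ fun s t hst => ?_
  have hst' : max a (min s b) ≤ max a (min t b) := by gcongr
  have h1 := varFun_sub_varFun hab h hst
  have h2 := varFun_sub_varFun hcd h' hst
  have h3 : (eVariationOn γ (Icc (max c (min s d)) (max c (min t d)))).toReal ≤
      (eVariationOn γ (Icc (max a (min s b)) (max a (min t b)))).toReal := by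
    refine ENNReal.toReal_mono (h.mono (Icc_subset_Icc (le_max_left _ _)
      (max_le hab (min_le_right _ _)))) ?_
    by_cases hlt : max c (min s d) < max c (min t d)
    · refine eVariationOn.mono γ (Icc_subset_Icc ?_ ?_) <;>
      rcases max_cases c (min t d) with h | h <;> rcases max_cases c (min s d) with h' | h' <;>
      rcases min_cases t d with h'' | h'' <;> rcases min_cases s d with h''' | h''' <;>
      simp <;> grind
    · rw [eVariationOn.subsingleton]
      · simp
      · exact subsingleton_Icc_of_ge (not_lt.1 hlt)
  dsimp only
  linarith

theorem exists_isPreconnected_lift_meeting_sphere {n : ℕ} {D : Set (EuclideanSpace ℝ (Fin n))}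
    {f : EuclideanSpace ℝ (Fin n) → EuclideanSpace ℝ (Fin n)} (hf : ContinuousOn f D)
    (hfo : IsOpenOn n D f) {x₀ x₁ : EuclideanSpace ℝ (Fin n)} {C : ℝ}
    (hC : closedBall x₀ C ⊆ D) {J : Set (EuclideanSpace ℝ (Fin n))} (hJc : IsClosed J)
    (hJ : IsPreconnected J) (hx₁ : x₁ ∈ ball x₀ C) (hfx₁ : f x₁ ∈ J)
    (hne : ∀ V ⊆ ball x₀ C, IsCompact V → f '' V ≠ J) :
    ∃ Z, IsPreconnected Z ∧ x₁ ∈ Z ∧ Z ⊆ closedBall x₀ C ∧ (∀ z ∈ Z, f z ∈ J) ∧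
      ∃ z ∈ Z, dist z x₀ = C := by
  set W : Set (EuclideanSpace ℝ (Fin n)) := closedBall x₀ C ∩ f ⁻¹' J with hWdef
  have hW : IsCompact W :=
    (isCompact_closedBall x₀ C).of_isClosed_subset
      ((hf.mono hC).preimage_isClosed_of_isClosed isClosed_closedBall hJc) inter_subset_left
  have : CompactSpace W := isCompact_iff_compactSpace.1 hW
  let w₁ : W := ⟨x₁, ball_subset_closedBall hx₁, hfx₁⟩
  refine ⟨Subtype.val '' connectedComponent w₁,
    isPreconnected_connectedComponent.image _ continuous_subtype_val.continuousOn,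
    ⟨w₁, mem_connectedComponent, rfl⟩, ?_, ?_, ?_⟩
  · rintro _ ⟨w, -, rfl⟩
    exact w.2.1
  · rintro _ ⟨w, -, rfl⟩
    exact w.2.2
  by_contra! hcon
  have hlt : ∀ w ∈ connectedComponent w₁, dist (w : EuclideanSpace ℝ (Fin n)) x₀ < C :=
    fun w hw => lt_of_le_of_ne w.2.1 (hcon _ ⟨w, hw, rfl⟩)
  obtain ⟨⟨V, hV, hwV⟩, hVlt⟩ : ∃ V : {s : Set W // IsClopen s ∧ w₁ ∈ s},
      (V : Set W) ⊆ {w | dist (w : EuclideanSpace ℝ (Fin n)) x₀ < C} := by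
    have : Nonempty {s : Set W // IsClopen s ∧ w₁ ∈ s} := ⟨⟨univ, isClopen_univ, mem_univ _⟩⟩
    refine exists_subset_nhds_of_compactSpace (fun s t => ?_) (fun s => s.2.1.1) fun w hw => ?_
    · exact ⟨⟨s ∩ t, s.2.1.inter t.2.1, s.2.2, t.2.2⟩, inter_subset_left, inter_subset_right⟩
    · rw [← connectedComponent_eq_iInter_isClopen] at hw
      exact (isOpen_lt (by fun_prop) continuous_const).mem_nhds (hlt w hw)
  obtain ⟨U, hU, rfl⟩ := isOpen_induced_iff.1 hV.2
  have hVball : Subtype.val '' (Subtype.val ⁻¹' U : Set W) ⊆ ball x₀ C := by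
    rintro _ ⟨w, hw, rfl⟩
    exact hVlt hw
  have hVc : IsCompact (Subtype.val '' (Subtype.val ⁻¹' U : Set W)) :=
    hV.1.isCompact.image continuous_subtype_val
  refine hne _ hVball hVc (Subset.antisymm ?_ ?_)
  · rintro _ ⟨_, ⟨w, -, rfl⟩, rfl⟩
    exact w.2.2
  have hO : IsOpen (f '' (U ∩ ball x₀ C)) :=
    hfo _ (hU.inter isOpen_ball) (inter_subset_right.trans (ball_subset_closedBall.trans hC))
  have hcl : IsClosed (f '' (Subtype.val '' (Subtype.val ⁻¹' U : Set W))) :=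
    (hVc.image_of_continuousOn (hf.mono (hVball.trans (ball_subset_closedBall.trans hC)))).isClosed
  have hmem : ∀ y ∈ J, y ∈ f '' (U ∩ ball x₀ C) →
      y ∈ f '' (Subtype.val '' (Subtype.val ⁻¹' U : Set W)) := by
    rintro _ hy ⟨x, hx, rfl⟩
    exact ⟨x, ⟨⟨x, ball_subset_closedBall hx.2, hy⟩, hx.1, rfl⟩, rfl⟩
  intro y hy
  by_contra hyV
  obtain ⟨z, hz, hzO, hzV⟩ := hJ _ _ hO hcl.isOpen_compl
    (fun y _ => by
      by_cases h : y ∈ f '' (Subtype.val '' (Subtype.val ⁻¹' U : Set W))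
      · left
        obtain ⟨_, ⟨w, hw, rfl⟩, rfl⟩ := h
        exact ⟨w, ⟨hw, hVlt hw⟩, rfl⟩
      · exact Or.inr h)
    ⟨f x₁, hfx₁, x₁, ⟨hwV, hx₁⟩, rfl⟩ ⟨y, hy, hyV⟩
  exact hzV (hmem z hz hzO)

theorem exists_crossing_subinterval {g : ℝ → ℝ} {u v r₁ r₂ : ℝ} (hg : ContinuousOn g (Icc u v))
    (hu : g u < r₁) (hr : r₁ < r₂) (hv : ∃ t ∈ Icc u v, r₂ ≤ g t) :
    ∃ c w, u < c ∧ c < w ∧ w ≤ v ∧ g c = r₁ ∧ g w = r₂ ∧ ∀ t ∈ Ioo c w, r₁ < g t ∧ g t < r₂ := by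
  obtain ⟨w, ⟨hw, hgw⟩, hwmin⟩ :=
    (isCompact_Icc.of_isClosed_subset
      (hg.preimage_isClosed_of_isClosed isClosed_Icc (isClosed_Ici (a := r₂)))
      inter_subset_left).exists_isLeast hv
  have hgw' : g w = r₂ := by
    obtain ⟨t, ht, htr⟩ := intermediate_value_Icc hw.1 (hg.mono (Icc_subset_Icc_right hw.2))
      ⟨(hu.trans hr).le, hgw⟩
    have := hwmin ⟨⟨ht.1, ht.2.trans hw.2⟩, htr.ge⟩
    rwa [← le_antisymm ht.2 this]
  have hlt : ∀ t ∈ Ico u w, g t < r₂ := fun t ht => by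
    by_contra! h
    exact absurd (hwmin ⟨⟨ht.1, ht.2.le.trans hw.2⟩, h⟩) (not_le.2 ht.2)
  obtain ⟨c, ⟨hc, hgc⟩, hcmax⟩ :=
    (isCompact_Icc.of_isClosed_subset
      ((hg.mono (Icc_subset_Icc_right hw.2)).preimage_isClosed_of_isClosed isClosed_Icc
        (isClosed_Iic (a := r₁))) inter_subset_left).exists_isGreatest
      ⟨u, left_mem_Icc.2 hw.1, hu.le⟩
  have hgc' : g c = r₁ := by
    obtain ⟨t, ht, htr⟩ := intermediate_value_Icc hc.2
      (hg.mono (Icc_subset_Icc hc.1 hw.2)) ⟨hgc, hgw'.symm ▸ hr.le⟩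
    have := hcmax ⟨⟨hc.1.trans ht.1, ht.2⟩, htr.le⟩
    rwa [le_antisymm ht.1 this]
  refine ⟨c, w, lt_of_le_of_ne hc.1 ?_, lt_of_le_of_ne hc.2 ?_, hw.2, hgc', hgw',
    fun t ht => ⟨?_, hlt t ⟨hc.1.trans ht.1.le, ht.2⟩⟩⟩
  · rintro rfl
    exact hu.ne hgc'
  · rintro rfl
    exact hr.ne (hgc'.symm.trans hgw')
  · by_contra! h
    exact absurd (hcmax ⟨⟨hc.1.trans ht.1.le, ht.2.le⟩, h⟩) (not_le.2 ht.1)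

theorem edist_le_lintegral_of_crossing {X ι : Type*} [MetricSpace X] {β : ℝ → X} {a b : ℝ}
    (hab : a ≤ b) (hβ : ContinuousOn β (Icc a b)) (ν : Measure ℝ) (F : ℝ → ℝ≥0∞)
    (T : Finset ι) (y : ι → X) (s : ι → ℝ) {S : ℝ} (hs : ∀ i ∈ T, 0 < s i) (hS : ∀ i ∈ T, s i ≤ S)
    (hcov : ∀ t ∈ Icc a b, ∃ i ∈ T, dist (β t) (y i) < 5 * s i)
    (hcross : ∀ i ∈ T, ∀ c d, a ≤ c → c < d → d ≤ b → dist (β c) (y i) = 5 * s i →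
      dist (β d) (y i) = 10 * s i →
      (∀ t ∈ Ioo c d, 5 * s i < dist (β t) (y i) ∧ dist (β t) (y i) < 10 * s i) →
      ENNReal.ofReal (s i) ≤ ∫⁻ t in Icc c d, F t ∂ν) :
    edist (β a) (β b) ≤ 20 * (∫⁻ t in Icc a b, F t ∂ν) + ENNReal.ofReal (20 * S) := by
  obtain ⟨i₀, hi₀, -⟩ := hcov a (left_mem_Icc.2 hab)
  obtain ⟨i₁, hi₁, hmin⟩ := T.exists_min_image s ⟨i₀, hi₀⟩
  obtain ⟨η, hη, hunif⟩ := Metric.uniformContinuousOn_iff.1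
    (isCompact_Icc.uniformContinuousOn_of_continuous hβ) (5 * s i₁)
    (by have := hs i₁ hi₁; positivity)
  have key : ∀ k : ℕ, ∀ u v, a ≤ u → u ≤ v → v ≤ b → v - u ≤ k * η →
      edist (β u) (β v) ≤ 20 * (∫⁻ t in Ioc u v, F t ∂ν) + ENNReal.ofReal (20 * S) := by
    intro k
    induction k with
    | zero =>
      intro u v _ huv _ h
      obtain rfl : u = v := le_antisymm huv (by simpa using h)
      simp
    | succ k ih =>
      intro u v hau huv hvb h
      obtain ⟨i, hi, hui⟩ := hcov u ⟨hau, huv.trans hvb⟩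
      have hsi := hs i hi
      by_cases hstay : ∃ t ∈ Icc u v, 10 * s i ≤ dist (β t) (y i)
      · obtain ⟨c, w, huc, hcw, hwv, hc, hw, hin⟩ := exists_crossing_subinterval
          (g := fun t => dist (β t) (y i)) (r₁ := 5 * s i) (r₂ := 10 * s i)
          (continuous_dist.comp_continuousOn
            ((hβ.mono (Icc_subset_Icc hau hvb)).prodMk continuousOn_const)) hui (by linarith) hstay
        have hcr := hcross i hi c w (hau.trans huc.le) hcw (hwv.trans hvb) hc hw hin
        have hdist : dist (β u) (β w) ≤ 20 * s i := by
          linarith [dist_triangle_right (β u) (β w) (y i)]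
        have hstep : η ≤ w - u := by
          by_contra! hlt
          have h1 := hunif u ⟨hau, huv.trans hvb⟩ w ⟨by linarith, hwv.trans hvb⟩ (by
            rw [dist_comm, Real.dist_eq, abs_of_nonneg (by linarith)]; exact hlt)
          linarith [dist_triangle_left (β w) (y i) (β u), hmin i hi]
        have hrec := ih w v (by linarith) hwv hvb (by push_cast at h; linarith)
        have hunion : ∫⁻ t in Ioc u v, F t ∂ν =
            (∫⁻ t in Ioc u w, F t ∂ν) + ∫⁻ t in Ioc w v, F t ∂ν := by
          rw [← Ioc_union_Ioc_eq_Ioc (huc.trans hcw).le hwv,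
            lintegral_union measurableSet_Ioc (Ioc_disjoint_Ioc_of_le le_rfl)]
        have hfirst : edist (β u) (β w) ≤ 20 * ∫⁻ t in Ioc u w, F t ∂ν := by
          rw [edist_dist]
          calc ENNReal.ofReal (dist (β u) (β w)) ≤ ENNReal.ofReal (20 * s i) :=
                ENNReal.ofReal_le_ofReal hdist
            _ = 20 * ENNReal.ofReal (s i) := by
                rw [ENNReal.ofReal_mul (by norm_num), ENNReal.ofReal_ofNat]
            _ ≤ 20 * ∫⁻ t in Icc c w, F t ∂ν := by gcongr
            _ ≤ _ := by
                gcongr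
        calc edist (β u) (β v) ≤ edist (β u) (β w) + edist (β w) (β v) := edist_triangle _ _ _
          _ ≤ _ := add_le_add hfirst hrec
          _ = _ := by rw [hunion]; ring
      · push Not at hstay
        refine le_add_left ?_
        rw [edist_dist]
        refine ENNReal.ofReal_le_ofReal ?_
        linarith [dist_triangle_right (β u) (β v) (y i), hstay v (right_mem_Icc.2 huv), hS i hi]
  obtain ⟨k, hk⟩ := exists_nat_ge ((b - a) / η)
  refine (key k a b le_rfl hab le_rfl ((div_le_iff₀ hη).1 hk)).trans ?_
  gcongr
  exact Ioc_subset_Icc_self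

theorem exists_radius_measure_closedBall_le {n : ℕ} (hn : 1 ≤ n)
    {μ : Measure (EuclideanSpace ℝ (Fin n))} (hvol : volume ≤ μ) (y : EuclideanSpace ℝ (Fin n))
    {s₀ : ℝ} (hs₀ : 0 < s₀) (hfin : μ (closedBall y s₀) ≠ ∞) :
    ∃ s, 0 < s ∧ s ≤ s₀ ∧ μ (closedBall y (10 * s)) ≤ 20 ^ n * μ (closedBall y s) := by
  by_contra! hcon
  have hiter : ∀ j : ℕ, (20 ^ n) ^ j * μ (closedBall y (s₀ / 10 ^ j)) ≤ μ (closedBall y s₀) := by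
    intro j
    induction j with
    | zero => simp
    | succ j ih =>
      refine le_trans ?_ ih
      have h1 := (hcon (s₀ / 10 ^ (j + 1)) (by positivity)
        (div_le_self hs₀.le (one_le_pow₀ (by norm_num)))).le
      have h2 : 10 * (s₀ / 10 ^ (j + 1)) = s₀ / 10 ^ j := by
        rw [pow_succ]; field_simp
      rw [h2] at h1
      calc _ = (20 ^ n) ^ j * (20 ^ n * μ (closedBall y (s₀ / 10 ^ (j + 1)))) := by ring
        _ ≤ _ := by gcongr
  set ω : ℝ≥0∞ := volume (ball (0 : EuclideanSpace ℝ (Fin n)) 1)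
  have hω : 0 < ω.toReal :=
    ENNReal.toReal_pos (measure_ball_pos _ _ one_pos).ne' measure_ball_lt_top.ne
  obtain ⟨j, hj⟩ := pow_unbounded_of_one_lt
    ((μ (closedBall y s₀)).toReal / (s₀ ^ n * ω.toReal)) (one_lt_two (α := ℝ))
  rw [div_lt_iff₀ (by positivity)] at hj
  have h1 : (20 ^ n) ^ j * (ENNReal.ofReal ((s₀ / 10 ^ j) ^ n) * ω) ≤ μ (closedBall y s₀) := by
    refine le_trans ?_ (hiter j)
    gcongr
    refine le_trans (le_of_eq ?_) (hvol _)
    rw [Measure.addHaar_closedBall _ _ (by positivity), finrank_euclideanSpace_fin]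
  have h2 := ENNReal.toReal_mono hfin h1
  rw [ENNReal.toReal_mul, ENNReal.toReal_mul, ENNReal.toReal_ofReal (by positivity)] at h2
  simp only [ENNReal.toReal_pow, ENNReal.toReal_ofNat] at h2
  have h3 : ((20 : ℝ) ^ n) ^ j * ((s₀ / 10 ^ j) ^ n * ω.toReal) =
      (2 ^ j) ^ n * (s₀ ^ n * ω.toReal) := by
    rw [div_pow, ← pow_mul, ← pow_mul, ← pow_mul, mul_comm n j,
      show (20 : ℝ) = 2 * 10 by norm_num, mul_pow]
    field_simp
  have h4 : (2 : ℝ) ^ j ≤ (2 ^ j) ^ n := le_self_pow₀ (one_le_pow₀ (by norm_num)) (by omega)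
  have h5 : (2 : ℝ) ^ j * (s₀ ^ n * ω.toReal) ≤ (2 ^ j) ^ n * (s₀ ^ n * ω.toReal) := by gcongr
  linarith

theorem exists_admissible_of_invPoletsky_on_ring {n : ℕ} {D : Set (EuclideanSpace ℝ (Fin n))}
    {f : EuclideanSpace ℝ (Fin n) → EuclideanSpace ℝ (Fin n)} {Q : EuclideanSpace ℝ (Fin n) → ℝ≥0∞}
    {y : EuclideanSpace ℝ (Fin n)} {r s : ℝ} (hs : 0 < s) (hsr : 10 * s < r)
    (hP : ∀ r₁ r₂ : ℝ, 0 < r₁ → r₁ < r₂ → r₂ < r →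
      ∀ η : ℝ → ℝ≥0∞, Measurable η → 1 ≤ ∫⁻ r in Ioo r₁ r₂, η r →
        modulus n (liftedFamily n D f y r₁ r₂) ≤
          ∫⁻ y' in (f '' D) ∩ annulus n y r₁ r₂, Q y' * η (dist y' y) ^ n)
    {B : ℝ≥0∞} (hB : ∫⁻ y' in closedBall y (10 * s), Q y' < B) :
    ∃ ρ, IsAdmissibleFor n ρ (liftedFamily n D f y (5 * s) (10 * s)) ∧
      ENNReal.ofReal s ^ n * ∫⁻ x, ρ x ^ n ≤ B := by
  set σ := ENNReal.ofReal s with hσ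
  have hσ0 : σ ≠ 0 := by simpa [hσ] using hs
  have hσt : σ ≠ ∞ := ENNReal.ofReal_ne_top
  have hmod : modulus n (liftedFamily n D f y (5 * s) (10 * s)) < σ⁻¹ ^ n * B := by
    refine (hP (5 * s) (10 * s) (by positivity) (by linarith) hsr (fun _ => σ⁻¹)
      measurable_const ?_).trans_lt ?_
    · rw [setLIntegral_const, Real.volume_Ioo, show 10 * s - 5 * s = 5 * s by ring,
        ENNReal.ofReal_mul (by norm_num), ← hσ, mul_left_comm, ENNReal.inv_mul_cancel hσ0 hσt]
      simp
    · calc ∫⁻ y' in (f '' D) ∩ annulus n y (5 * s) (10 * s), Q y' * σ⁻¹ ^ n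
          = (∫⁻ y' in (f '' D) ∩ annulus n y (5 * s) (10 * s), Q y') * σ⁻¹ ^ n := by
            rw [lintegral_mul_const']
            simp [hσ0]
        _ ≤ (∫⁻ y' in closedBall y (10 * s), Q y') * σ⁻¹ ^ n := by
            gcongr
            exact fun x hx => hx.2.2.le
        _ < B * σ⁻¹ ^ n := by
            refine ENNReal.mul_lt_mul_left ?_ ?_ hB
            · simp [hσt]
            · simp [hσ0]
        _ = _ := mul_comm _ _
  simp only [modulus, iInf_lt_iff] at hmod
  obtain ⟨ρ, hρ, hlt⟩ := hmod
  refine ⟨ρ, hρ, ?_⟩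
  calc _ ≤ σ ^ n * (σ⁻¹ ^ n * B) := by gcongr
    _ = B := by
      rw [← mul_assoc, ← mul_pow, ENNReal.mul_inv_cancel hσ0 hσt, one_pow, one_mul]

theorem one_le_arcIntegral_of_crossing_rings {n : ℕ} {D : Set (EuclideanSpace ℝ (Fin n))}
    {f : EuclideanSpace ℝ (Fin n) → EuclideanSpace ℝ (Fin n)} (hf : ContinuousOn f D)
    {δ : ℝ} (hδ : 0 < δ) {y₁ : EuclideanSpace ℝ (Fin n)} {R : ℝ} {ι : Type*} (T : Finset ι)
    (y : ι → EuclideanSpace ℝ (Fin n)) (s : ι → ℝ) (hs : ∀ i ∈ T, 0 < s i)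
    (hS : ∀ i ∈ T, s i ≤ δ / 100)
    (hcov : ∀ z ∈ closedBall y₁ (R + δ), ∃ i ∈ T, dist z (y i) < 5 * s i)
    {ρ : EuclideanSpace ℝ (Fin n) → ℝ≥0∞}
    {ρ' : ι → EuclideanSpace ℝ (Fin n) → ℝ≥0∞}
    (hρ' : ∀ i ∈ T, IsAdmissibleFor n (ρ' i) (liftedFamily n D f (y i) (5 * s i) (10 * s i)))
    (hle : ∀ i ∈ T, ∀ x, ENNReal.ofReal (s i) * ρ' i x ≤ ρ x)
    {γ : ℝ → EuclideanSpace ℝ (Fin n)} {a b : ℝ} (hab : a ≤ b) (hγ : ContinuousOn γ (Icc a b))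
    (hγD : MapsTo γ (Icc a b) D) (hstart : dist (f (γ a)) y₁ ≤ R)
    (hend : δ ≤ dist (f (γ a)) (f (γ b))) :
    1 ≤ arcIntegral n (fun x => ENNReal.ofReal (25 / δ) * ρ x) γ a b := by
  by_cases hbv : BoundedVariationOn γ (Icc a b)
  swap
  · rw [arcIntegral, dif_neg fun h => hbv h.1]
    exact le_top
  rw [arcIntegral_eq _ hab hbv]
  set ν := (varFun_monotone hab hbv).stieltjesFunction.measure
  have hβ : ContinuousOn (f ∘ γ) (Icc a b) := hf.comp hγ hγD
  have hdist : ContinuousOn (fun t => dist (f (γ t)) (f (γ a))) (Icc a b) :=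
    continuous_dist.comp_continuousOn (hβ.prodMk continuousOn_const)
  obtain ⟨b', hb', hb'δ, hin⟩ : ∃ b' ∈ Icc a b, dist (f (γ b')) (f (γ a)) = δ ∧
      ∀ t ∈ Icc a b', dist (f (γ t)) (f (γ a)) ≤ δ := by
    obtain ⟨b', ⟨hb', hgb⟩, hmin⟩ :=
      (isCompact_Icc.of_isClosed_subset
        (hdist.preimage_isClosed_of_isClosed isClosed_Icc (isClosed_Ici (a := δ)))
        inter_subset_left).exists_isLeast ⟨b, right_mem_Icc.2 hab, by
          rw [mem_preimage, dist_comm]; exact hend⟩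
    obtain ⟨t, ht, htδ⟩ := intermediate_value_Icc hb'.1
      (hdist.mono (Icc_subset_Icc_right hb'.2)) (show δ ∈ Icc _ _ from ⟨by simpa using hδ.le, hgb⟩)
    obtain rfl : t = b' := le_antisymm ht.2 (hmin ⟨⟨ht.1, ht.2.trans hb'.2⟩, htδ.ge⟩)
    refine ⟨t, hb', htδ, fun u hu => ?_⟩
    by_contra! h
    have := hmin ⟨⟨hu.1, hu.2.trans hb'.2⟩, h.le⟩
    obtain rfl : u = t := le_antisymm hu.2 this
    exact h.ne' htδ
  have hsub : Icc a b' ⊆ Icc a b := Icc_subset_Icc_right hb'.2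
  have hchain := edist_le_lintegral_of_crossing hb'.1 (hβ.mono hsub) ν (fun t => ρ (γ t)) T y s
    hs hS (fun t ht => hcov _ (by
      change dist (f (γ t)) y₁ ≤ R + δ
      linarith [dist_triangle (f (γ t)) (f (γ a)) y₁, hin t ht]))
    (fun i hi c d hac hcd hdb hc hd hin' => by
      have hsub' : Icc c d ⊆ Icc a b := Icc_subset_Icc hac (hdb.trans hb'.2)
      have h1 := (hρ' i hi).2 ⟨c, d, hcd.le, γ, hγ.mono hsub'⟩
        ⟨fun t ht => hγD (hsub' ht), hc, hd, hin'⟩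
      have h2 := arcIntegral_le_of_subinterval (ρ' i) hac hcd.le (hdb.trans hb'.2) hbv
      calc ENNReal.ofReal (s i)
          ≤ ENNReal.ofReal (s i) * ∫⁻ t in Icc c d, ρ' i (γ t) ∂ν :=
            le_mul_of_one_le_right' (h1.trans h2)
        _ = ∫⁻ t in Icc c d, ENNReal.ofReal (s i) * ρ' i (γ t) ∂ν :=
            (lintegral_const_mul' _ _ ENNReal.ofReal_ne_top).symm
        _ ≤ _ := lintegral_mono fun t => hle i hi _)
  have hmono : ∫⁻ t in Icc a b', ρ (γ t) ∂ν ≤ ∫⁻ t in Icc a b, ρ (γ t) ∂ν :=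
    lintegral_mono_set hsub
  rw [lintegral_const_mul' _ _ ENNReal.ofReal_ne_top]
  set I := ∫⁻ t in Icc a b, ρ (γ t) ∂ν
  by_cases hI : I = ∞
  · rw [hI, ENNReal.mul_top]
    · exact le_top
    · simpa using hδ
  have hb'' : edist ((f ∘ γ) a) ((f ∘ γ) b') = ENNReal.ofReal δ := by
    rw [edist_dist, dist_comm, ← hb'δ]
    rfl
  rw [hb''] at hchain
  have h3 : ENNReal.ofReal δ ≤ ENNReal.ofReal (20 * I.toReal + 20 * (δ / 100)) := by
    refine (hchain.trans (add_le_add_left (mul_le_mul_right hmono _) _)).trans (le_of_eq ?_)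
    rw [ENNReal.ofReal_add (by positivity) (by positivity),
      ENNReal.ofReal_mul (q := I.toReal) (by norm_num),
      ENNReal.ofReal_toReal hI, ENNReal.ofReal_ofNat]
  rw [ENNReal.ofReal_le_ofReal_iff (by positivity)] at h3
  rw [← ENNReal.ofReal_toReal hI, ← ENNReal.ofReal_mul (by positivity), ENNReal.one_le_ofReal,
    div_mul_eq_mul_div, le_div_iff₀ hδ]
  linarith

theorem exists_admissible_of_invPoletsky {n : ℕ} (hn : 1 ≤ n)
    {D : Set (EuclideanSpace ℝ (Fin n))}
    {f : EuclideanSpace ℝ (Fin n) → EuclideanSpace ℝ (Fin n)} (hf : ContinuousOn f D)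
    {Q : EuclideanSpace ℝ (Fin n) → ℝ≥0∞}
    (hQloc : ∀ K : Set (EuclideanSpace ℝ (Fin n)), IsCompact K → (∫⁻ y in K, Q y) < ∞)
    (hP : ∀ y, InvPoletsky n D f Q y) (y₁ : EuclideanSpace ℝ (Fin n)) (R : ℝ) {δ : ℝ}
    (hδ : 0 < δ) :
    ∃ ρ : EuclideanSpace ℝ (Fin n) → ℝ≥0∞, Measurable ρ ∧
      ∫⁻ x, ρ x ^ n ≤ ENNReal.ofReal (25 / δ) ^ n *
        (20 ^ n * ∫⁻ y in closedBall y₁ (R + 2 * δ), (Q y + 1)) ∧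
      ∀ (γ : ℝ → EuclideanSpace ℝ (Fin n)) (a b : ℝ), a ≤ b → ContinuousOn γ (Icc a b) →
        MapsTo γ (Icc a b) D → dist (f (γ a)) y₁ ≤ R → δ ≤ dist (f (γ a)) (f (γ b)) →
        1 ≤ arcIntegral n ρ γ a b := by
  set μ : Measure (EuclideanSpace ℝ (Fin n)) := volume.withDensity (fun y => Q y + 1) with hμ
  have hvol : volume ≤ μ := by
    conv_lhs => rw [← withDensity_one (μ := volume)]
    exact withDensity_mono (Eventually.of_forall fun y => le_add_self)
  have hμint : ∀ y r, μ (closedBall y r) = ∫⁻ z in closedBall y r, (Q z + 1) :=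
    fun y r => withDensity_apply _ measurableSet_closedBall
  have hμadd : ∀ y r, μ (closedBall y r) =
      (∫⁻ z in closedBall y r, Q z) + volume (closedBall y r) := fun y r => by
    rw [hμint, lintegral_add_right _ measurable_const, setLIntegral_const, one_mul]
  have hμfin : ∀ y r, μ (closedBall y r) ≠ ∞ := fun y r => by
    rw [hμadd]
    exact ENNReal.add_ne_top.2
      ⟨(hQloc _ (isCompact_closedBall y r)).ne, measure_closedBall_lt_top.ne⟩
  choose r hr hPr using hP
  have hs : ∀ y, ∃ s, 0 < s ∧ s ≤ min (r y / 11) (δ / 100) ∧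
      μ (closedBall y (10 * s)) ≤ 20 ^ n * μ (closedBall y s) := fun y =>
    exists_radius_measure_closedBall_le hn hvol y
      (lt_min (div_pos (hr y) (by norm_num)) (by positivity)) (hμfin _ _)
  choose s hs0 hsle hsdoub using hs
  obtain ⟨T₀, hT₀K, hT₀⟩ := (isCompact_closedBall y₁ (R + δ)).elim_nhds_subcover
    (fun y => ball y (s y)) fun y _ => ball_mem_nhds y (hs0 y)
  obtain ⟨u, huT, hdisj, hcov⟩ := Vitali.exists_disjoint_subfamily_covering_enlargement_closedBall
    (T₀ : Set (EuclideanSpace ℝ (Fin n))) id s (δ / 100)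
    (fun y _ => (hsle y).trans (min_le_right _ _)) 4 (by norm_num)
  have hufin : u.Finite := T₀.finite_toSet.subset huT
  set T := hufin.toFinset with hT
  have hring : ∀ y, ∃ ρ, IsAdmissibleFor n ρ (liftedFamily n D f y (5 * s y) (10 * s y)) ∧
      ENNReal.ofReal (s y) ^ n * ∫⁻ x, ρ x ^ n ≤ μ (closedBall y (10 * s y)) := fun y => by
    have hs10 : 10 * s y < r y := by
      have := (hsle y).trans (min_le_left _ _)
      linarith [hs0 y]
    refine exists_admissible_of_invPoletsky_on_ring (hs0 y) hs10 (hPr y) ?_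
    rw [hμadd]
    exact ENNReal.lt_add_right (hQloc _ (isCompact_closedBall _ _)).ne
      (measure_closedBall_pos _ _ (by linarith [hs0 y])).ne'
  choose ρ' hρ' hρ'int using hring
  set ρ : EuclideanSpace ℝ (Fin n) → ℝ≥0∞ :=
    fun x => T.sup fun y => ENNReal.ofReal (s y) * ρ' y x with hρdef
  have hρ : Measurable ρ := by
    simp only [hρdef, Finset.sup_eq_iSup]
    exact Measurable.biSup (T : Set (EuclideanSpace ℝ (Fin n))) T.countable_toSet
      fun y _ => (hρ' y).1.const_mul _
  refine ⟨fun x => ENNReal.ofReal (25 / δ) * ρ x, hρ.const_mul _, ?_, ?_⟩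
  · simp_rw [mul_pow]
    rw [lintegral_const_mul _ (hρ.pow_const n)]
    gcongr
    rw [← hμint]
    calc ∫⁻ x, ρ x ^ n ≤ ∫⁻ x, ∑ y ∈ T, ENNReal.ofReal (s y) ^ n * ρ' y x ^ n := by
          refine lintegral_mono fun x => ?_
          rcases T.eq_empty_or_nonempty with h | h
          · simp [hρdef, h, show n ≠ 0 by omega]
          · obtain ⟨y, hy, hyx⟩ := T.exists_mem_eq_sup h fun y => ENNReal.ofReal (s y) * ρ' y x
            simp only [hρdef, hyx, mul_pow]
            exact Finset.single_le_sum
              (f := fun y => ENNReal.ofReal (s y) ^ n * ρ' y x ^ n) (fun _ _ => zero_le) hy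
      _ = ∑ y ∈ T, ENNReal.ofReal (s y) ^ n * ∫⁻ x, ρ' y x ^ n := by
          rw [lintegral_finsetSum _ fun y _ => ((hρ' y).1.pow_const n).const_mul _]
          refine Finset.sum_congr rfl fun y _ => ?_
          rw [lintegral_const_mul _ ((hρ' y).1.pow_const n)]
      _ ≤ ∑ y ∈ T, 20 ^ n * μ (closedBall y (s y)) :=
          Finset.sum_le_sum fun y _ => (hρ'int y).trans (hsdoub y)
      _ = 20 ^ n * μ (⋃ y ∈ T, closedBall y (s y)) := by
          rw [← Finset.mul_sum, measure_biUnion_finset _ fun _ _ => measurableSet_closedBall]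
          simpa [hT] using hdisj
      _ ≤ _ := by
          gcongr
          refine iUnion₂_subset fun y hy => ?_
          have h1 := mem_closedBall.1 (hT₀K y (huT (hufin.mem_toFinset.1 hy)))
          refine closedBall_subset_closedBall' ?_
          linarith [(hsle y).trans (min_le_right _ _)]
  · intro γ a b hab hγ hγD hstart hend
    refine one_le_arcIntegral_of_crossing_rings hf hδ T id s (fun y _ => hs0 y)
      (fun y _ => (hsle y).trans (min_le_right _ _)) (fun z hz => ?_) (fun y _ => hρ' y)
      (fun y hy x => Finset.le_sup (f := fun y => ENNReal.ofReal (s y) * ρ' y x) hy)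
      hab hγ hγD hstart hend
    obtain ⟨y, hy, hzy⟩ := mem_iUnion₂.1 (hT₀ hz)
    obtain ⟨y', hy', hsub⟩ := hcov y hy
    refine ⟨y', hufin.mem_toFinset.2 hy', ?_⟩
    have := mem_closedBall.1 (hsub (ball_subset_closedBall hzy))
    linarith [hs0 y']

theorem setLIntegral_le_const_add_setLIntegral_pow {α : Type*} [MeasurableSpace α] {μ : Measure α}
    {g : α → ℝ≥0∞} (hg : Measurable g) (B : Set α) (m : ℕ) {l : ℝ} (hl : 0 < l) :
    ∫⁻ x in B, g x ∂μ ≤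
      ENNReal.ofReal l * μ B + ENNReal.ofReal (l⁻¹ ^ m) * ∫⁻ x in B, g x ^ (m + 1) ∂μ := by
  have hpt : ∀ x, g x ≤ ENNReal.ofReal l + ENNReal.ofReal (l⁻¹ ^ m) * g x ^ (m + 1) := by
    intro x
    rcases le_total (g x) (ENNReal.ofReal l) with h | h
    · exact h.trans le_self_add
    · refine le_trans ?_ le_add_self
      calc g x = ENNReal.ofReal (l⁻¹ ^ m) * (ENNReal.ofReal l ^ m * g x) := by
            rw [← mul_assoc, ← ENNReal.ofReal_pow hl.le, ← ENNReal.ofReal_mul (by positivity),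
              ← mul_pow, inv_mul_cancel₀ hl.ne']
            simp
        _ ≤ ENNReal.ofReal (l⁻¹ ^ m) * (g x ^ m * g x) := by gcongr
        _ = _ := by rw [pow_succ]
  calc ∫⁻ x in B, g x ∂μ
      ≤ ∫⁻ x in B, (ENNReal.ofReal l + ENNReal.ofReal (l⁻¹ ^ m) * g x ^ (m + 1)) ∂μ :=
        lintegral_mono hpt
    _ = _ := by
        rw [lintegral_add_left measurable_const, setLIntegral_const,
          lintegral_const_mul _ (hg.pow_const _)]

theorem setLIntegral_comp_homothety_le {m : ℕ}
    {g : EuclideanSpace ℝ (Fin (m + 1)) → ℝ≥0∞} (hg : Measurable g)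
    (z : EuclideanSpace ℝ (Fin (m + 1))) {R σ : ℝ} (hσ : 0 < σ)
    {P : Set (EuclideanSpace ℝ (Fin (m + 1)))} (hP : ∀ y ∈ P, dist y z ≤ R) :
    ∫⁻ y in P, g (z + σ • (y - z)) ≤
      ENNReal.ofReal ((σ ^ (m + 1))⁻¹) * ∫⁻ w in closedBall z (R * σ), g w := by
  set h := (closedBall z (R * σ)).indicator g
  have hh : Measurable h := hg.indicator measurableSet_closedBall
  have hmap := lintegral_map (μ := volume) (f := fun w => h (z + w))
    (g := fun v : EuclideanSpace ℝ (Fin (m + 1)) => σ • v) (by fun_prop) (by fun_prop)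
  rw [Measure.map_addHaar_smul _ hσ.ne', finrank_euclideanSpace_fin,
    abs_of_pos (by positivity), lintegral_smul_measure, lintegral_add_left_eq_self] at hmap
  calc ∫⁻ y in P, g (z + σ • (y - z))
      ≤ ∫⁻ y in closedBall z R, g (z + σ • (y - z)) := lintegral_mono_set hP
    _ ≤ ∫⁻ y in closedBall z R, h (z + σ • (y - z)) := by
        refine setLIntegral_mono' measurableSet_closedBall fun y hy => ?_
        refine le_of_eq (indicator_of_mem ?_ g).symm
        rw [mem_closedBall, dist_eq_norm] at hy ⊢
        rw [add_sub_cancel_left, norm_smul, Real.norm_of_nonneg hσ.le, mul_comm]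
        gcongr
    _ ≤ ∫⁻ y, h (z + σ • (y - z)) := setLIntegral_le_lintegral _ _
    _ = ∫⁻ v, h (z + σ • v) := lintegral_sub_right_eq_self (fun v => h (z + σ • v)) z
    _ = _ := by
        rw [← hmap, smul_eq_mul]
        congr 1
        exact lintegral_indicator measurableSet_closedBall g

theorem lintegral_segment_le_of_small_energy {m : ℕ}
    {g : EuclideanSpace ℝ (Fin (m + 1)) → ℝ≥0∞} (hg : Measurable g)
    (z : EuclideanSpace ℝ (Fin (m + 1))) {t κ : ℝ} (ht : 0 < t) (hκ : 0 < κ)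
    {P : Set (EuclideanSpace ℝ (Fin (m + 1)))} (hP : ∀ y ∈ P, dist y z ≤ 3 * t)
    (hsmall : ∀ σ ∈ Ioc (0 : ℝ) 1,
      ∫⁻ w in closedBall z (3 * t * σ), g w ^ (m + 1) ≤ ENNReal.ofReal (κ ^ (m + 1) * σ)) :
    ∫⁻ y in P, ∫⁻ σ in Ioc (0 : ℝ) 1, g (z + σ • (y - z)) ≤
      ENNReal.ofReal (κ * t ^ m * (3 ^ (m + 1) *
        (volume (ball (0 : EuclideanSpace ℝ (Fin (m + 1))) 1)).toReal + 1)) *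
        ∫⁻ σ in Ioc (0 : ℝ) 1, ENNReal.ofReal (σ ^ (1 / ((m : ℝ) + 1) - 1)) := by
  set ω := (volume (ball (0 : EuclideanSpace ℝ (Fin (m + 1))) 1)).toReal with hω
  have hω0 : 0 ≤ ω := ENNReal.toReal_nonneg
  have hvol : ∀ r, 0 ≤ r → volume (closedBall z r) = ENNReal.ofReal (r ^ (m + 1) * ω) := by
    intro r hr
    rw [Measure.addHaar_closedBall _ _ hr, finrank_euclideanSpace_fin,
      ENNReal.ofReal_mul (by positivity), hω, ENNReal.ofReal_toReal measure_ball_lt_top.ne]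
  rw [lintegral_lintegral_swap (Measurable.aemeasurable (by fun_prop)),
    ← lintegral_const_mul _ (by fun_prop)]
  refine setLIntegral_mono' measurableSet_Ioc fun σ hσ => ?_
  have hσ0 : 0 < σ := hσ.1
  obtain ⟨q, hq0, hqn, hq⟩ : ∃ q : ℝ, 0 < q ∧ q ^ (m + 1) = σ ∧
      σ ^ (1 / ((m : ℝ) + 1) - 1) = q / σ := by
    refine ⟨σ ^ (1 / ((m : ℝ) + 1)), by positivity, ?_, ?_⟩
    · rw [← Real.rpow_natCast, ← Real.rpow_mul hσ0.le]
      push_cast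
      rw [one_div_mul_cancel (by positivity), Real.rpow_one]
    · rw [Real.rpow_sub_one hσ0.ne']
  rw [hq]
  set l := κ * q / (σ * t) with hl
  have hl0 : 0 < l := by positivity
  refine (setLIntegral_comp_homothety_le hg z hσ0 hP).trans ?_
  calc ENNReal.ofReal ((σ ^ (m + 1))⁻¹) * ∫⁻ w in closedBall z (3 * t * σ), g w
      ≤ ENNReal.ofReal ((σ ^ (m + 1))⁻¹) * (ENNReal.ofReal l * volume (closedBall z (3 * t * σ)) +
          ENNReal.ofReal (l⁻¹ ^ m) * ∫⁻ w in closedBall z (3 * t * σ), g w ^ (m + 1)) := by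
        gcongr
        exact setLIntegral_le_const_add_setLIntegral_pow hg _ m hl0
    _ ≤ ENNReal.ofReal ((σ ^ (m + 1))⁻¹) *
          (ENNReal.ofReal l * ENNReal.ofReal ((3 * t * σ) ^ (m + 1) * ω) +
          ENNReal.ofReal (l⁻¹ ^ m) * ENNReal.ofReal (κ ^ (m + 1) * σ)) := by
        rw [hvol _ (by positivity)]
        gcongr
        exact hsmall σ hσ
    _ = ENNReal.ofReal (κ * t ^ m * (3 ^ (m + 1) * ω + 1)) * ENNReal.ofReal (q / σ) := by
        rw [← ENNReal.ofReal_mul (by positivity), ← ENNReal.ofReal_mul (by positivity),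
          ← ENNReal.ofReal_add (by positivity) (by positivity),
          ← ENNReal.ofReal_mul (by positivity), ← ENNReal.ofReal_mul (by positivity)]
        congr 1
        have h1 : (σ ^ (m + 1))⁻¹ * (l * ((3 * t * σ) ^ (m + 1) * ω)) =
            κ * t ^ m * (3 ^ (m + 1) * ω) * (q / σ) := by
          rw [hl]
          field_simp
          ring
        have h2 : (σ ^ (m + 1))⁻¹ * (l⁻¹ ^ m * (κ ^ (m + 1) * σ)) = κ * t ^ m * (q / σ) := by
          have h3 : l⁻¹ ^ m = σ ^ m * t ^ m / (κ ^ m * q ^ m) := by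
            rw [hl, inv_div, div_pow, mul_pow, mul_pow]
          rw [h3]
          have h4 : q ^ m = σ / q := by
            rw [← hqn, pow_succ]; field_simp
          rw [h4]
          field_simp
          ring
        rw [mul_add, h1, h2]
        ring

theorem lintegral_Ioc_rpow_ne_top {r : ℝ} (hr : -1 < r) :
    ∫⁻ σ in Ioc (0 : ℝ) 1, ENNReal.ofReal (σ ^ r) ≠ ∞ := by
  have h := (intervalIntegral.intervalIntegrable_rpow' (a := 0) (b := 1) hr).1
  have h2 := h.2
  rw [hasFiniteIntegral_iff_ofReal] at h2
  · exact h2.ne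
  · filter_upwards [ae_restrict_mem measurableSet_Ioc] with σ hσ
    exact Real.rpow_nonneg hσ.1.le _

theorem le_lintegral_of_large_energy {E : Type*} [NormedAddCommGroup E] [NormedSpace ℝ E]
    [TopologicalSpace.SeparableSpace E] [MeasurableSpace E] [OpensMeasurableSpace E] {μ : Measure E}
    (F : E → ℝ≥0∞) {Z : Set E} {z₀ : E} {t a : ℝ} (ht : 0 < t) (ha : 0 < a)
    (hcover : ∀ s ∈ Ico 0 (t / 8), ∃ z ∈ Z, dist z z₀ = s)
    (hlarge : ∀ z ∈ Z, ∃ σ ∈ Ioc (0 : ℝ) 1,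
      ENNReal.ofReal (a * σ) < ∫⁻ w in closedBall z (3 * t * σ), F w ∂μ) :
    ENNReal.ofReal (a / 192) ≤ ∫⁻ w, F w ∂μ := by
  choose! σ hσ hσF using hlarge
  obtain ⟨u, huZ, hdisj, hu⟩ := Vitali.exists_disjoint_subfamily_covering_enlargement_closedBall
    Z (fun z => z) (fun z => 3 * t * σ z) (3 * t)
    (fun z hz => by nlinarith [(hσ z hz).2]) 4 (by norm_num)
  have hcount : u.Countable := by
    refine hdisj.countable_of_nonempty_interior fun z hz => ?_
    have := (hσ z (huZ hz)).1
    exact ⟨z, ball_subset_interior_closedBall (mem_ball_self (by positivity))⟩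
  have hsub : Ico 0 (t / 8) ⊆ ⋃ z ∈ u, closedBall (dist z z₀) (12 * t * σ z) := by
    intro s hs
    obtain ⟨z, hz, rfl⟩ := hcover s hs
    obtain ⟨z', hz', hzz'⟩ := hu z hz
    have h0 := (hσ z hz).1
    have h1 : z ∈ closedBall z' (4 * (3 * t * σ z')) :=
      hzz' (mem_closedBall_self (by positivity))
    rw [mem_iUnion₂]
    refine ⟨z', hz', ?_⟩
    rw [mem_closedBall] at h1 ⊢
    calc dist (dist z z₀) (dist z' z₀) ≤ dist z z' := dist_dist_dist_le_left _ _ _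
      _ ≤ _ := by linarith
  have h1 : ENNReal.ofReal (t / 8) ≤ ∑' z : u, ENNReal.ofReal (24 * t * σ z) := by
    calc ENNReal.ofReal (t / 8) = volume (Ico 0 (t / 8)) := by rw [Real.volume_Ico, sub_zero]
      _ ≤ volume (⋃ z ∈ u, closedBall (dist z z₀) (12 * t * σ z)) := measure_mono hsub
      _ ≤ ∑' z : u, volume (closedBall (dist z.1 z₀) (12 * t * σ z)) :=
          measure_biUnion_le _ hcount _
      _ = _ := by
          congr 1 with z
          rw [Real.volume_closedBall]
          ring_nf
  have h2 : ∑' z : u, ENNReal.ofReal (a * σ z) ≤ ∫⁻ w, F w ∂μ := by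
    calc ∑' z : u, ENNReal.ofReal (a * σ z)
        ≤ ∑' z : u, ∫⁻ w in closedBall z.1 (3 * t * σ z), F w ∂μ :=
          ENNReal.tsum_le_tsum fun z => (hσF z (huZ z.2)).le
      _ = ∫⁻ w in ⋃ z ∈ u, closedBall z (3 * t * σ z), F w ∂μ :=
          (lintegral_biUnion hcount (fun _ _ => measurableSet_closedBall) hdisj _).symm
      _ ≤ _ := setLIntegral_le_lintegral _ _
  calc ENNReal.ofReal (a / 192) = ENNReal.ofReal (a / (24 * t)) * ENNReal.ofReal (t / 8) := by
        rw [← ENNReal.ofReal_mul (by positivity)]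
        congr 1
        field_simp
        norm_num
    _ ≤ ENNReal.ofReal (a / (24 * t)) * ∑' z : u, ENNReal.ofReal (24 * t * σ z) := by gcongr
    _ = ∑' z : u, ENNReal.ofReal (a * σ z) := by
        rw [← ENNReal.tsum_mul_left]
        congr 1 with z
        rw [← ENNReal.ofReal_mul (by positivity)]
        congr 1
        field_simp
    _ ≤ _ := h2

theorem exists_pos_le_lintegral_pow_of_segments (m : ℕ) : ∃ c > (0 : ℝ),
    ∀ (g : EuclideanSpace ℝ (Fin (m + 1)) → ℝ≥0∞) (t : ℝ)
      (Z Z' : Set (EuclideanSpace ℝ (Fin (m + 1)))) (p z₀ z₀' : EuclideanSpace ℝ (Fin (m + 1))),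
      Measurable g → 0 < t →
      (∀ z ∈ Z ∪ Z', ∀ y ∈ ball p (t / 8), dist y z ≤ 3 * t) →
      (∀ s ∈ Ico 0 (t / 8), ∃ z ∈ Z, dist z z₀ = s) →
      (∀ s ∈ Ico 0 (t / 8), ∃ z ∈ Z', dist z z₀' = s) →
      (∀ z ∈ Z, ∀ z' ∈ Z', ∀ y ∈ ball p (t / 8), 1 ≤ ENNReal.ofReal (6 * t) *
        ((∫⁻ σ in Ioc (0 : ℝ) 1, g (z + σ • (y - z))) +
          ∫⁻ σ in Ioc (0 : ℝ) 1, g (z' + σ • (y - z')))) →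
      ENNReal.ofReal c ≤ ∫⁻ x, g x ^ (m + 1) := by
  set ω := (volume (ball (0 : EuclideanSpace ℝ (Fin (m + 1))) 1)).toReal with hω
  have hω0 : 0 < ω := ENNReal.toReal_pos (measure_ball_pos _ _ one_pos).ne' measure_ball_lt_top.ne
  set I := ∫⁻ σ in Ioc (0 : ℝ) 1, ENNReal.ofReal (σ ^ (1 / ((m : ℝ) + 1) - 1)) with hI
  have hItop : I ≠ ∞ := lintegral_Ioc_rpow_ne_top (by
    have : 0 < 1 / ((m : ℝ) + 1) := by positivity
    linarith)
  set K := I.toReal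
  have hK : 0 ≤ K := ENNReal.toReal_nonneg
  set κ := ω / (12 * 8 ^ (m + 1) * ((3 ^ (m + 1) * ω + 1) * K + 1)) with hκ
  have hκ0 : 0 < κ := by positivity
  refine ⟨κ ^ (m + 1) / 192, by positivity, ?_⟩
  intro g t Z Z' p z₀ z₀' hg ht hdist hcov hcov' hpath
  by_cases hZ : ∀ z ∈ Z, ∃ σ ∈ Ioc (0 : ℝ) 1, ENNReal.ofReal (κ ^ (m + 1) * σ) <
      ∫⁻ w in closedBall z (3 * t * σ), g w ^ (m + 1)
  · exact le_lintegral_of_large_energy _ ht (by positivity) hcov hZ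
  by_cases hZ' : ∀ z ∈ Z', ∃ σ ∈ Ioc (0 : ℝ) 1, ENNReal.ofReal (κ ^ (m + 1) * σ) <
      ∫⁻ w in closedBall z (3 * t * σ), g w ^ (m + 1)
  · exact le_lintegral_of_large_energy _ ht (by positivity) hcov' hZ'
  exfalso
  push Not at hZ hZ'
  obtain ⟨z, hz, hzs⟩ := hZ
  obtain ⟨z', hz', hzs'⟩ := hZ'
  have h1 := lintegral_segment_le_of_small_energy hg z ht hκ0 (hdist z (Or.inl hz)) hzs
  have h2 := lintegral_segment_le_of_small_energy hg z' ht hκ0 (hdist z' (Or.inr hz')) hzs'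
  rw [← hω, ← hI, ← ENNReal.ofReal_toReal hItop, ← ENNReal.ofReal_mul (by positivity)] at h1 h2
  have h3 : volume (ball p (t / 8)) = ENNReal.ofReal ((t / 8) ^ (m + 1) * ω) := by
    rw [Measure.addHaar_ball _ _ (by positivity), finrank_euclideanSpace_fin,
      ENNReal.ofReal_mul (by positivity), hω, ENNReal.ofReal_toReal measure_ball_lt_top.ne]
  have h4 : volume (ball p (t / 8)) ≤ ENNReal.ofReal (6 * t) *
      (ENNReal.ofReal (κ * t ^ m * (3 ^ (m + 1) * ω + 1) * K) +
        ENNReal.ofReal (κ * t ^ m * (3 ^ (m + 1) * ω + 1) * K)) := by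
    calc volume (ball p (t / 8)) = ∫⁻ y in ball p (t / 8), 1 := by simp
      _ ≤ ∫⁻ y in ball p (t / 8), ENNReal.ofReal (6 * t) *
        ((∫⁻ σ in Ioc (0 : ℝ) 1, g (z + σ • (y - z))) +
          ∫⁻ σ in Ioc (0 : ℝ) 1, g (z' + σ • (y - z'))) :=
          setLIntegral_mono' measurableSet_ball fun y hy => hpath z hz z' hz' y hy
      _ = ENNReal.ofReal (6 * t) *
        ((∫⁻ y in ball p (t / 8), ∫⁻ σ in Ioc (0 : ℝ) 1, g (z + σ • (y - z))) +
          ∫⁻ y in ball p (t / 8), ∫⁻ σ in Ioc (0 : ℝ) 1, g (z' + σ • (y - z'))) := by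
          have hm : ∀ z, Measurable fun y => ∫⁻ σ in Ioc (0 : ℝ) 1, g (z + σ • (y - z)) :=
            fun z => Measurable.lintegral_prod_right'
              (f := fun q : EuclideanSpace ℝ (Fin (m + 1)) × ℝ => g (z + q.2 • (q.1 - z)))
              (by fun_prop)
          rw [lintegral_const_mul' _ _ ENNReal.ofReal_ne_top, lintegral_add_left (hm z)]
      _ ≤ _ := by gcongr
  rw [h3, ← ENNReal.ofReal_add (by positivity) (by positivity),
    ← ENNReal.ofReal_mul (by positivity), ENNReal.ofReal_le_ofReal_iff (by positivity)] at h4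
  have h5 : κ * (12 * 8 ^ (m + 1) * ((3 ^ (m + 1) * ω + 1) * K + 1)) = ω := by
    rw [hκ]; field_simp
  have h6 : (t / 8) ^ (m + 1) * ω * 8 ^ (m + 1) = t ^ (m + 1) * ω := by
    rw [div_pow]; field_simp
  have h7 : t ^ (m + 1) * ω ≤
      t ^ (m + 1) * (κ * (12 * 8 ^ (m + 1) * ((3 ^ (m + 1) * ω + 1) * K))) := by
    rw [← h6]
    refine (mul_le_mul_of_nonneg_right h4 (by positivity)).trans_eq ?_
    ring
  have h8 := le_of_mul_le_mul_left h7 (by positivity)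
  have : 0 < κ * (12 * 8 ^ (m + 1)) := by positivity
  nlinarith

theorem setLIntegral_Icc_comp_two_sub (F : ℝ → ℝ≥0∞) :
    ∫⁻ s in Icc (1 : ℝ) 2, F (2 - s) = ∫⁻ s in Icc (0 : ℝ) 1, F s := by
  rw [← lintegral_indicator measurableSet_Icc, ← lintegral_indicator measurableSet_Icc,
    ← lintegral_sub_left_eq_self _ (2 : ℝ)]
  congr 1 with s
  simp only [indicator, mem_Icc]
  congr 1
  · exact propext ⟨fun h => ⟨by linarith [h.2], by linarith [h.1]⟩,
      fun h => ⟨by linarith [h.2], by linarith [h.1]⟩⟩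
  · rw [sub_sub_cancel]

theorem exists_path_arcIntegral_le_segments {n : ℕ} (ρ : EuclideanSpace ℝ (Fin n) → ℝ≥0∞)
    {z z' y : EuclideanSpace ℝ (Fin n)} {l : ℝ} (hz : dist y z ≤ l) (hz' : dist y z' ≤ l) :
    ∃ γ : ℝ → EuclideanSpace ℝ (Fin n), Continuous γ ∧ γ 0 = z ∧ γ 2 = z' ∧
      (∀ s ∈ Icc (0 : ℝ) 2, ∃ σ ∈ Icc (0 : ℝ) 1,
        γ s = z + σ • (y - z) ∨ γ s = z' + σ • (y - z')) ∧
      arcIntegral n ρ γ 0 2 ≤ ENNReal.ofReal (2 * l) *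
        ((∫⁻ σ in Ioc (0 : ℝ) 1, ρ (z + σ • (y - z))) +
          ∫⁻ σ in Ioc (0 : ℝ) 1, ρ (z' + σ • (y - z'))) := by
  set γ : ℝ → EuclideanSpace ℝ (Fin n) :=
    fun s => y + max (1 - s) 0 • (z - y) + max (s - 1) 0 • (z' - y) with hγ
  have hl : 0 ≤ l := dist_nonneg.trans hz
  have hγ1 : ∀ s ≤ (1 : ℝ), γ s = z + s • (y - z) := by
    intro s hs
    simp only [hγ]
    rw [max_eq_left (by linarith), max_eq_right (by linarith)]
    module
  have hγ2 : ∀ s ≥ (1 : ℝ), γ s = z' + (2 - s) • (y - z') := by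
    intro s hs
    simp only [hγ]
    rw [max_eq_right (by linarith), max_eq_left (by linarith)]
    module
  have hLip : LipschitzWith (2 * l).toNNReal γ := by
    refine LipschitzWith.of_dist_le_mul fun s s' => ?_
    rw [Real.coe_toNNReal _ (by positivity), dist_eq_norm]
    have h1 : γ s - γ s' = (max (1 - s) 0 - max (1 - s') 0) • (z - y) +
        (max (s - 1) 0 - max (s' - 1) 0) • (z' - y) := by
      simp only [hγ]; module
    have h2 : |max (1 - s) 0 - max (1 - s') 0| ≤ dist s s' := by
      refine (abs_max_sub_max_le_abs _ _ _).trans_eq ?_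
      rw [Real.dist_eq, ← abs_neg]; congr 1; ring
    have h3 : |max (s - 1) 0 - max (s' - 1) 0| ≤ dist s s' := by
      refine (abs_max_sub_max_le_abs _ _ _).trans_eq ?_
      rw [Real.dist_eq]; congr 1; ring
    rw [dist_comm, dist_eq_norm] at hz hz'
    rw [h1]
    refine (norm_add_le _ _).trans ?_
    rw [norm_smul, norm_smul, Real.norm_eq_abs, Real.norm_eq_abs]
    calc _ ≤ dist s s' * l + dist s s' * l := by gcongr
      _ = _ := by ring
  refine ⟨γ, hLip.continuous, by rw [hγ1 0 zero_le_one]; simp,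
    by rw [hγ2 2 one_le_two]; simp, ?_, ?_⟩
  · intro s hs
    rcases le_total s 1 with h | h
    · exact ⟨s, ⟨hs.1, h⟩, Or.inl (hγ1 s h)⟩
    · exact ⟨2 - s, ⟨by linarith [hs.2], by linarith⟩, Or.inr (hγ2 s h)⟩
  · refine (arcIntegral_le_of_lipschitzOnWith ρ zero_le_two hLip.lipschitzOnWith).trans ?_
    change ENNReal.ofReal (2 * l) * _ ≤ _
    gcongr
    rw [← Icc_union_Icc_eq_Icc zero_le_one one_le_two]
    refine (lintegral_union_le _ _ _).trans ?_
    gcongr ?_ + ?_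
    · rw [setLIntegral_congr_fun (g := fun s => ρ (z + s • (y - z))) measurableSet_Icc
        fun s hs => by simp only [hγ1 s hs.2], restrict_Ioc_eq_restrict_Icc]
    · rw [setLIntegral_congr_fun (g := fun s => ρ (z' + (2 - s) • (y - z'))) measurableSet_Icc
        fun s hs => by simp only [hγ2 s hs.1], restrict_Ioc_eq_restrict_Icc,
        setLIntegral_Icc_comp_two_sub fun s => ρ (z' + s • (y - z'))]

theorem exists_norm_eq_inner_nonneg {n : ℕ} (hn : 2 ≤ n) (u v : EuclideanSpace ℝ (Fin n)) {t : ℝ}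
    (ht : 0 < t) :
    ∃ w : EuclideanSpace ℝ (Fin n), ‖w‖ = t ∧ 0 ≤ inner ℝ u w ∧ 0 ≤ inner ℝ v w := by
  obtain ⟨w, hw, hw0⟩ : ∃ w : EuclideanSpace ℝ (Fin n), inner ℝ u w = 0 ∧ w ≠ 0 := by
    have hlt : Module.finrank ℝ (Submodule.span ℝ {u}) <
        Module.finrank ℝ (EuclideanSpace ℝ (Fin n)) := by
      rw [finrank_euclideanSpace_fin]
      exact (finrank_span_le_card {u}).trans_lt (by simp; omega)
    have hne : (Submodule.span ℝ {u})ᗮ ≠ ⊥ := by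
      intro h
      rw [Submodule.orthogonal_eq_bot_iff] at h
      rw [h, finrank_top] at hlt
      exact hlt.false
    obtain ⟨w, hw, hw0⟩ := Submodule.exists_mem_ne_zero_of_ne_bot hne
    exact ⟨w, Submodule.mem_orthogonal_singleton_iff_inner_right.1 hw, hw0⟩
  have hnorm : 0 < ‖w‖ := norm_pos_iff.2 hw0
  rcases le_total 0 (inner ℝ v w) with h | h
  · refine ⟨(t / ‖w‖) • w, ?_, ?_, ?_⟩
    · rw [norm_smul, Real.norm_of_nonneg (by positivity), div_mul_cancel₀ _ hnorm.ne']
    · rw [inner_smul_right, hw, mul_zero]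
    · rw [inner_smul_right]; positivity
  · refine ⟨-((t / ‖w‖) • w), ?_, ?_, ?_⟩
    · rw [norm_neg, norm_smul, Real.norm_of_nonneg (by positivity), div_mul_cancel₀ _ hnorm.ne']
    · rw [inner_neg_right, inner_smul_right, hw, mul_zero, neg_zero]
    · rw [inner_neg_right, inner_smul_right]
      have : 0 ≤ t / ‖w‖ := by positivity
      nlinarith

theorem segment_mem_annulus {n : ℕ} {x₀ z₀ p z y : EuclideanSpace ℝ (Fin n)} {t σ : ℝ}
    (ht : 0 < t) (hz₀ : dist z₀ x₀ = t) (hp : dist p x₀ = t)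
    (hinner : 0 ≤ inner ℝ (z₀ - x₀) (p - x₀)) (hz : dist z z₀ < t / 8) (hy : dist y p < t / 8)
    (hσ : σ ∈ Icc (0 : ℝ) 1) : z + σ • (y - z) ∈ annulus n x₀ (t / 2) (2 * t) := by
  rw [dist_eq_norm] at hz₀ hp hz hy
  have hσ0 := hσ.1
  have hσ1 : 0 ≤ 1 - σ := by linarith [hσ.2]
  set q := (1 - σ) • (z₀ - x₀) + σ • (p - x₀) with hq
  have hdecomp : z + σ • (y - z) - x₀ = q + ((1 - σ) • (z - z₀) + σ • (y - p)) := by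
    rw [hq]; module
  have herr : ‖(1 - σ) • (z - z₀) + σ • (y - p)‖ ≤ t / 8 := by
    refine (norm_add_le _ _).trans ?_
    rw [norm_smul, norm_smul, Real.norm_of_nonneg hσ0, Real.norm_of_nonneg hσ1]
    nlinarith
  have hqsq : ‖q‖ ^ 2 = (1 - σ) ^ 2 * t ^ 2 + 2 * ((1 - σ) * σ * inner ℝ (z₀ - x₀) (p - x₀)) +
      σ ^ 2 * t ^ 2 := by
    rw [hq, norm_add_sq_real, norm_smul, norm_smul, Real.norm_of_nonneg hσ0,
      Real.norm_of_nonneg hσ1, hz₀, hp, inner_smul_left, inner_smul_right]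
    simp
    ring
  have hqhi : ‖q‖ ≤ t := by
    rw [hq]
    refine (norm_add_le _ _).trans ?_
    rw [norm_smul, norm_smul, Real.norm_of_nonneg hσ0, Real.norm_of_nonneg hσ1, hz₀, hp]
    linarith
  have hqlo : t * (2 / 3) ≤ ‖q‖ := by
    refine (pow_le_pow_iff_left₀ (by positivity) (norm_nonneg _) two_ne_zero).1 ?_
    rw [hqsq]
    have h1 : 0 ≤ (1 - σ) * σ * inner ℝ (z₀ - x₀) (p - x₀) := by positivity
    nlinarith [mul_nonneg (sq_nonneg t) (sq_nonneg (2 * σ - 1)), sq_nonneg t]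
  simp only [annulus, mem_ofPred_eq, dist_eq_norm, hdecomp]
  constructor
  · have := norm_sub_le_norm_add q ((1 - σ) • (z - z₀) + σ • (y - p))
    linarith
  · have := norm_add_le q ((1 - σ) • (z - z₀) + σ • (y - p))
    linarith

theorem isOpen_annulus (n : ℕ) (y₀ : EuclideanSpace ℝ (Fin n)) (r₁ r₂ : ℝ) :
    IsOpen (annulus n y₀ r₁ r₂) :=
  have hd : Continuous fun y => dist y y₀ := by fun_prop
  (isOpen_lt continuous_const hd).inter (isOpen_lt hd continuous_const)

theorem IsPreconnected.exists_mem_ball_dist_eq {X : Type*} [MetricSpace X] {Z : Set X}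
    (hZ : IsPreconnected Z) {x₀ z₀ z₁ : X} {t : ℝ} (hz₀ : z₀ ∈ Z) (hz₁ : z₁ ∈ Z)
    (h₀ : dist z₀ x₀ = t) (h₁ : dist z₁ x₀ ≤ t / 2) {s : ℝ} (hs : s ∈ Ico 0 (t / 8)) :
    ∃ z ∈ Z ∩ ball z₀ (t / 8), dist z z₀ = s := by
  have hle : s ≤ dist z₁ z₀ := by
    have := dist_triangle_left z₀ x₀ z₁
    have := hs.1
    have := hs.2
    linarith
  obtain ⟨z, hz, hzs⟩ := hZ.intermediate_value (f := fun z => dist z z₀) hz₀ hz₁ (by fun_prop)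
    ⟨by simpa using hs.1, hle⟩
  exact ⟨z, ⟨hz, by rw [mem_ball]; exact hzs.trans_lt hs.2⟩, hzs⟩

theorem exists_pos_le_lintegral_annulus {n : ℕ} (hn : 2 ≤ n) : ∃ c > (0 : ℝ),
    ∀ (ρ : EuclideanSpace ℝ (Fin n) → ℝ≥0∞) (x₀ : EuclideanSpace ℝ (Fin n)) (t : ℝ)
      (Z Z' : Set (EuclideanSpace ℝ (Fin n))),
      Measurable ρ → 0 < t → IsPreconnected Z → IsPreconnected Z' →
      (∃ z ∈ Z, dist z x₀ = t) → (∃ z ∈ Z, dist z x₀ ≤ t / 2) →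
      (∃ z ∈ Z', dist z x₀ = t) → (∃ z ∈ Z', dist z x₀ ≤ t / 2) →
      (∀ (γ : ℝ → EuclideanSpace ℝ (Fin n)) (a b : ℝ), a ≤ b → ContinuousOn γ (Icc a b) →
        MapsTo γ (Icc a b) (ball x₀ (2 * t)) → γ a ∈ Z → γ b ∈ Z' → 1 ≤ arcIntegral n ρ γ a b) →
      ENNReal.ofReal c ≤ ∫⁻ x in annulus n x₀ (t / 2) (2 * t), ρ x ^ n := by
  obtain ⟨m, rfl⟩ : ∃ m, n = m + 1 := ⟨n - 1, by omega⟩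
  obtain ⟨c, hc, h⟩ := exists_pos_le_lintegral_pow_of_segments m
  refine ⟨c, hc, ?_⟩
  rintro ρ x₀ t Z Z' hρ ht hZ hZ' ⟨z₀, hz₀, hz₀t⟩ ⟨z₁, hz₁, hz₁t⟩ ⟨z₀', hz₀', hz₀t'⟩
    ⟨z₁', hz₁', hz₁t'⟩ hpath
  obtain ⟨w, hwt, hw, hw'⟩ := exists_norm_eq_inner_nonneg hn (z₀ - x₀) (z₀' - x₀) ht
  set p := x₀ + w with hp
  have hpw : p - x₀ = w := by rw [hp]; abel
  have hpt : dist p x₀ = t := by rw [dist_eq_norm, hpw, hwt]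
  rw [← hpw] at hw hw'
  have hA : MeasurableSet (annulus (m + 1) x₀ (t / 2) (2 * t)) :=
    (isOpen_annulus _ _ _ _).measurableSet
  set g := (annulus (m + 1) x₀ (t / 2) (2 * t)).indicator ρ with hg
  have hgρ : ∫⁻ x in annulus (m + 1) x₀ (t / 2) (2 * t), ρ x ^ (m + 1) = ∫⁻ x, g x ^ (m + 1) := by
    rw [← lintegral_indicator hA]
    congr 1 with x
    by_cases hx : x ∈ annulus (m + 1) x₀ (t / 2) (2 * t) <;> simp [g, hx]
  have hdist : ∀ z z₀, dist z₀ x₀ = t → dist z z₀ < t / 8 → ∀ y ∈ ball p (t / 8),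
      dist y z ≤ 3 * t := by
    intro z z₀ hz₀ hz y hy
    rw [mem_ball] at hy
    have h1 := dist_triangle4 y p x₀ z
    have h2 := dist_triangle x₀ z₀ z
    rw [dist_comm x₀ z₀, dist_comm z₀ z] at h2
    linarith
  have hseg : ∀ z z₀, dist z₀ x₀ = t → 0 ≤ inner ℝ (z₀ - x₀) (p - x₀) → dist z z₀ < t / 8 →
      ∀ y ∈ ball p (t / 8), ∫⁻ σ in Ioc (0 : ℝ) 1, ρ (z + σ • (y - z)) =
        ∫⁻ σ in Ioc (0 : ℝ) 1, g (z + σ • (y - z)) := by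
    intro z z₀ hz₀ hi hz y hy
    refine setLIntegral_congr_fun measurableSet_Ioc fun σ hσ => ?_
    exact (indicator_of_mem
      (segment_mem_annulus ht hz₀ hpt hi hz hy (Ioc_subset_Icc_self hσ)) ρ).symm
  rw [hgρ]
  refine h g t (Z ∩ ball z₀ (t / 8)) (Z' ∩ ball z₀' (t / 8)) p z₀ z₀' (hρ.indicator hA) ht ?_
    (fun s hs => hZ.exists_mem_ball_dist_eq hz₀ hz₁ hz₀t hz₁t hs)
    (fun s hs => hZ'.exists_mem_ball_dist_eq hz₀' hz₁' hz₀t' hz₁t' hs) ?_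
  · rintro z (hz | hz)
    · exact hdist z z₀ hz₀t hz.2
    · exact hdist z z₀' hz₀t' hz.2
  · intro z hz z' hz' y hy
    obtain ⟨γ, hγ, hγ0, hγ2, hγseg, hγarc⟩ := exists_path_arcIntegral_le_segments ρ
      (hdist z z₀ hz₀t hz.2 y hy) (hdist z' z₀' hz₀t' hz'.2 y hy)
    refine (hpath γ 0 2 zero_le_two hγ.continuousOn ?_ (hγ0 ▸ hz.1) (hγ2 ▸ hz'.1)).trans ?_
    · intro s hs
      obtain ⟨σ, hσ, hs | hs⟩ := hγseg s hs <;> rw [hs]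
      · exact (segment_mem_annulus ht hz₀t hpt hw hz.2 hy hσ).2
      · exact (segment_mem_annulus ht hz₀t' hpt hw' hz'.2 hy hσ).2
    · rw [hseg z z₀ hz₀t hw hz.2 y hy, hseg z' z₀' hz₀t' hw' hz'.2 y hy] at hγarc
      refine hγarc.trans_eq ?_
      congr 2
      ring

theorem exists_pos_mul_le_lintegral_of_connected_sets {n : ℕ} (hn : 2 ≤ n) : ∃ c > (0 : ℝ),
    ∀ (N : ℕ) (ρ : EuclideanSpace ℝ (Fin n) → ℝ≥0∞) (x₀ : EuclideanSpace ℝ (Fin n)) (C : ℝ)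
      (Z Z' : Set (EuclideanSpace ℝ (Fin n))),
      Measurable ρ → 0 < C → IsPreconnected Z → IsPreconnected Z' →
      (∃ z ∈ Z, dist z x₀ = C) → (∃ z ∈ Z, dist z x₀ ≤ C / 4 ^ N) →
      (∃ z ∈ Z', dist z x₀ = C) → (∃ z ∈ Z', dist z x₀ ≤ C / 4 ^ N) →
      (∀ (γ : ℝ → EuclideanSpace ℝ (Fin n)) (a b : ℝ), a ≤ b → ContinuousOn γ (Icc a b) →
        MapsTo γ (Icc a b) (ball x₀ C) → γ a ∈ Z → γ b ∈ Z' → 1 ≤ arcIntegral n ρ γ a b) →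
      N * ENNReal.ofReal c ≤ ∫⁻ x, ρ x ^ n := by
  obtain ⟨c, hc, h⟩ := exists_pos_le_lintegral_annulus hn
  refine ⟨c, hc, ?_⟩
  intro N ρ x₀ C Z Z' hρ hC hZ hZ' hZC hZN hZC' hZN' hpath
  set t : ℕ → ℝ := fun j => C / 2 / 4 ^ j with ht
  have ht0 : ∀ j, 0 < t j := fun j => by positivity
  have hhalf : ∀ j, t j / 2 = C / 4 ^ (j + 1) := fun j => by
    simp only [ht, pow_succ]; field_simp; norm_num
  have htwo : ∀ j, 2 * t j = C / 4 ^ j := fun j => by simp only [ht]; field_simp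
  have hanti : ∀ {i j : ℕ}, i ≤ j → C / 4 ^ j ≤ C / 4 ^ i := fun hij => by
    gcongr; norm_num
  have hmeet : ∀ W : Set (EuclideanSpace ℝ (Fin n)), IsPreconnected W →
      (∃ z ∈ W, dist z x₀ = C) → (∃ z ∈ W, dist z x₀ ≤ C / 4 ^ N) → ∀ j < N,
      (∃ z ∈ W, dist z x₀ = t j) ∧ ∃ z ∈ W, dist z x₀ ≤ t j / 2 := by
    rintro W hW ⟨z, hz, hzC⟩ ⟨z', hz', hzN⟩ j hj
    have h1 : dist z' x₀ ≤ t j / 2 := by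
      rw [hhalf]; exact hzN.trans (hanti hj)
    refine ⟨?_, z', hz', h1⟩
    have h2 := hanti (Nat.zero_le j)
    rw [← htwo, pow_zero, div_one] at h2
    have := ht0 j
    exact hW.intermediate_value (f := fun z => dist z x₀) hz' hz (by fun_prop)
      ⟨by linarith, by linarith⟩
  calc (N : ℝ≥0∞) * ENNReal.ofReal c = ∑ j ∈ Finset.range N, ENNReal.ofReal c := by simp
    _ ≤ ∑ j ∈ Finset.range N, ∫⁻ x in annulus n x₀ (t j / 2) (2 * t j), ρ x ^ n := by
        refine Finset.sum_le_sum fun j hj => ?_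
        rw [Finset.mem_range] at hj
        obtain ⟨h1, h2⟩ := hmeet Z hZ hZC hZN j hj
        obtain ⟨h3, h4⟩ := hmeet Z' hZ' hZC' hZN' j hj
        refine h ρ x₀ (t j) Z Z' hρ (ht0 j) hZ hZ' h1 h2 h3 h4 fun γ a b hab hγ hm => ?_
        refine hpath γ a b hab hγ (hm.mono_right (ball_subset_ball ?_))
        rw [htwo]
        exact (hanti (Nat.zero_le j)).trans_eq (by simp)
    _ = ∫⁻ x in ⋃ j ∈ Finset.range N, annulus n x₀ (t j / 2) (2 * t j), ρ x ^ n := by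
        refine (lintegral_biUnion_finset ?_ (fun j _ => (isOpen_annulus _ _ _ _).measurableSet)
          _).symm
        have hlt : ∀ i j, i < j → Disjoint (annulus n x₀ (t i / 2) (2 * t i))
            (annulus n x₀ (t j / 2) (2 * t j)) := by
          intro i j hij
          refine disjoint_left.2 fun x hx hx' => ?_
          have h1 := hx.1
          have h2 := hx'.2
          rw [hhalf] at h1
          rw [htwo] at h2
          exact (h1.trans h2).not_ge (hanti hij)
        intro i _ j _ hij
        rcases hij.lt_or_gt with h' | h'
        · exact hlt i j h'
        · exact (hlt j i h').symm
    _ ≤ _ := setLIntegral_le_lintegral _ _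

theorem dist_le_two_mul_dist_of_mem_segment_of_mem_ray {E : Type*} [NormedAddCommGroup E]
    [InnerProductSpace ℝ E] {a b y p q : E} (hab : dist a y ≤ dist b y) (hp : p ∈ segment ℝ y a)
    (hq : q ∈ (fun s : ℝ => y + s • (b - y)) '' Ici 1) : dist a b ≤ 2 * dist p q := by
  rw [segment_eq_image'] at hp
  obtain ⟨θ, hθ, rfl⟩ := hp
  obtain ⟨s, hs, rfl⟩ := hq
  rw [mem_Ici] at hs
  simp only [dist_eq_norm] at hab ⊢
  set u := a - y
  set v := b - y
  have h1 : a - b = u - v := by simp [u, v]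
  rw [h1, add_sub_add_left_eq_sub]
  have hθu : ‖θ • u‖ = θ * ‖u‖ := by rw [norm_smul, Real.norm_of_nonneg hθ.1]
  have hle : ‖θ • u‖ ≤ ‖v‖ := by
    rw [hθu]
    exact (mul_le_of_le_one_left (norm_nonneg _) hθ.2).trans hab
  have h2 : ‖θ • u - v‖ ≤ ‖θ • u - s • v‖ := by
    refine (pow_le_pow_iff_left₀ (norm_nonneg _) (norm_nonneg _) two_ne_zero).1 ?_
    rw [norm_sub_sq_real _ v, norm_sub_sq_real _ (s • v), inner_smul_right, norm_smul s,
      Real.norm_of_nonneg (by linarith)]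
    have h3 : inner ℝ (θ • u) v ≤ ‖v‖ ^ 2 :=
      (real_inner_le_norm _ _).trans (by rw [sq]; gcongr)
    nlinarith [mul_nonneg (sub_nonneg.2 hs) (sub_nonneg.2 h3),
      mul_nonneg (mul_nonneg (sub_nonneg.2 hs) (sub_nonneg.2 hs)) (sq_nonneg ‖v‖)]
  have h4 : ‖u - θ • u‖ = ‖u‖ - ‖θ • u‖ := by
    have : u - θ • u = (1 - θ) • u := by module
    rw [this, hθu, norm_smul, Real.norm_of_nonneg (by linarith [hθ.2])]
    ring
  have h5 := norm_sub_le_norm_sub_add_norm_sub u (θ • u) v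
  have h6 := norm_sub_norm_le v (θ • u)
  rw [norm_sub_rev v] at h6
  linarith

theorem chordal_comm (n : ℕ) (a b : EuclideanSpace ℝ (Fin n)) : chordal n a b = chordal n b a := by
  rw [chordal, chordal, dist_comm, mul_comm]

theorem chordal_le_dist (n : ℕ) (a b : EuclideanSpace ℝ (Fin n)) : chordal n a b ≤ dist a b := by
  refine div_le_self dist_nonneg (one_le_mul_of_one_le_of_one_le ?_ ?_) <;>
  exact Real.one_le_sqrt.2 (le_add_of_nonneg_right (by positivity))

theorem norm_le_or_norm_le_of_le_chordal {n : ℕ} {a b : EuclideanSpace ℝ (Fin n)} {ε : ℝ}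
    (hε : 0 < ε) (h : ε ≤ chordal n a b) : ‖a‖ ≤ 2 / ε ∨ ‖b‖ ≤ 2 / ε := by
  by_contra! hcon
  have key : ∀ x : EuclideanSpace ℝ (Fin n), ‖x‖ ≤ √(1 + ‖x‖ ^ 2) := fun x =>
    Real.le_sqrt_of_sq_le (by linarith)
  set α := √(1 + ‖a‖ ^ 2)
  set β := √(1 + ‖b‖ ^ 2)
  have hε2 : 0 < 2 / ε := by positivity
  have hα : 2 / ε < α := hcon.1.trans_le (key a)
  have hβ : 2 / ε < β := hcon.2.trans_le (key b)
  rw [div_lt_iff₀ hε] at hα hβ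
  have hα0 : 0 < α := by nlinarith
  have hβ0 : 0 < β := by nlinarith
  rw [chordal, le_div_iff₀ (by positivity)] at h
  have h1 : dist a b ≤ α + β := by
    rw [dist_eq_norm]
    exact (norm_sub_le _ _).trans (add_le_add (key a) (key b))
  nlinarith [mul_lt_mul_of_pos_right hα hβ0, mul_lt_mul_of_pos_left hβ hα0]

theorem isClosed_ray {n : ℕ} (y v : EuclideanSpace ℝ (Fin n)) :
    IsClosed ((fun s : ℝ => y + s • v) '' Ici 1) := by
  have h := (Homeomorph.addLeft y).isClosedMap.comp (isClosedMap_smul_left (𝕜 := ℝ) v)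
  exact h _ isClosed_Ici

theorem not_isBounded_ray {n : ℕ} (y : EuclideanSpace ℝ (Fin n)) {v : EuclideanSpace ℝ (Fin n)}
    (hv : v ≠ 0) : ¬ Bornology.IsBounded ((fun s : ℝ => y + s • v) '' Ici 1) := by
  intro h
  obtain ⟨M, hM⟩ := h.subset_closedBall y
  have hv0 : 0 < ‖v‖ := norm_pos_iff.2 hv
  have h1 := hM (mem_image_of_mem _ (mem_Ici.2 (le_max_left 1 (M / ‖v‖ + 1))))
  rw [mem_closedBall, dist_eq_norm, add_sub_cancel_left, norm_smul,
    Real.norm_of_nonneg (by positivity)] at h1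
  have h2 : (M / ‖v‖ + 1) * ‖v‖ = M + ‖v‖ := by field_simp
  have h3 := mul_le_mul_of_nonneg_right (le_max_right 1 (M / ‖v‖ + 1)) hv0.le
  linarith

theorem exists_radius_dist_lt_of_omitted_value {n : ℕ} (hn : 2 ≤ n)
    {D : Set (EuclideanSpace ℝ (Fin n))} {Q : EuclideanSpace ℝ (Fin n) → ℝ≥0∞}
    (hQloc : ∀ K : Set (EuclideanSpace ℝ (Fin n)), IsCompact K → (∫⁻ y in K, Q y) < ∞)
    {x₀ : EuclideanSpace ℝ (Fin n)} {C : ℝ} (hC : 0 < C) (hCD : closedBall x₀ C ⊆ D)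
    (y₁ : EuclideanSpace ℝ (Fin n)) (R : ℝ) {δ : ℝ} (hδ : 0 < δ) :
    ∃ r > (0 : ℝ), ∀ f : EuclideanSpace ℝ (Fin n) → EuclideanSpace ℝ (Fin n),
      ContinuousOn f D → IsOpenOn n D f → (∀ y, InvPoletsky n D f Q y) →
      (∀ x ∈ ball x₀ C, f x ≠ y₁) → ∀ x₁ ∈ ball x₀ r, ∀ x₂ ∈ ball x₀ r,
      dist (f x₁) y₁ ≤ R → dist (f x₁) y₁ ≤ dist (f x₂) y₁ → dist (f x₁) (f x₂) < 2 * δ := by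
  obtain ⟨c, hc, hlow⟩ := exists_pos_mul_le_lintegral_of_connected_sets hn
  set M := ENNReal.ofReal (25 / δ) ^ n *
    (20 ^ n * ∫⁻ y in closedBall y₁ (R + 2 * δ), (Q y + 1)) with hM
  have hMtop : M ≠ ∞ := by
    have hK := isCompact_closedBall y₁ (R + 2 * δ)
    have h1 : ∫⁻ y in closedBall y₁ (R + 2 * δ), (Q y + 1) ≠ ∞ := by
      rw [lintegral_add_right _ measurable_const, setLIntegral_one]
      exact ENNReal.add_ne_top.2 ⟨(hQloc _ hK).ne, hK.measure_lt_top.ne⟩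
    refine ENNReal.mul_ne_top (by simp) (ENNReal.mul_ne_top (by simp) h1)
  obtain ⟨N, hN⟩ := ENNReal.exists_nat_mul_gt (ENNReal.ofReal_pos.2 hc).ne' hMtop
  refine ⟨C / 4 ^ N, by positivity, ?_⟩
  intro f hf hfo hP hom x₁ hx₁ x₂ hx₂ hR hle
  by_contra! hcon
  have hrC : ball x₀ (C / 4 ^ N) ⊆ ball x₀ C :=
    ball_subset_ball (div_le_self hC.le (one_le_pow₀ (by norm_num)))
  have hbD : ball x₀ C ⊆ D := ball_subset_closedBall.trans hCD
  have hJ : IsClosed (segment ℝ y₁ (f x₁)) := by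
    rw [segment_eq_image']
    exact (isCompact_Icc.image (by fun_prop)).isClosed
  obtain ⟨Z, hZ, hxZ, -, hZJ, hZC⟩ := exists_isPreconnected_lift_meeting_sphere hf hfo hCD
    (J := segment ℝ y₁ (f x₁)) hJ
    (convex_segment _ _).isPreconnected (hrC hx₁) (right_mem_segment _ _ _) (by
      rintro V hV - hVJ
      obtain ⟨x, hx, hxy⟩ := hVJ.ge (left_mem_segment ℝ y₁ (f x₁))
      exact hom x (hV hx) hxy)
  obtain ⟨Z', hZ', hxZ', -, hZJ', hZC'⟩ := exists_isPreconnected_lift_meeting_sphere hf hfo hCD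
    (J := (fun s : ℝ => y₁ + s • (f x₂ - y₁)) '' Ici 1) (isClosed_ray _ _)
    (isPreconnected_Ici.image _ (by fun_prop)) (hrC hx₂) ⟨1, self_mem_Ici, by simp⟩ (by
      intro V hV hVc hVJ
      refine not_isBounded_ray y₁ (sub_ne_zero.2 (hom x₂ (hrC hx₂))) ?_
      rw [← hVJ]
      exact (hVc.image_of_continuousOn (hf.mono (hV.trans hbD))).isBounded)
  obtain ⟨ρ, hρ, hρM, hρadm⟩ := exists_admissible_of_invPoletsky (by omega) hf hQloc hP y₁ R hδ
  refine absurd (hN.trans_le (hlow N ρ x₀ C Z Z' hρ hC hZ hZ' hZC ⟨x₁, hxZ, le_of_lt hx₁⟩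
    hZC' ⟨x₂, hxZ', le_of_lt hx₂⟩ ?_)) hρM.not_gt
  intro γ a b hab hγ hmaps ha hb
  refine hρadm γ a b hab hγ (hmaps.mono_right hbD) ?_ ?_
  · obtain ⟨θ, hθ, hθe⟩ := (segment_eq_image' ℝ y₁ (f x₁)).le (hZJ _ ha)
    rw [← hθe, dist_eq_norm, add_sub_cancel_left, norm_smul, Real.norm_of_nonneg hθ.1,
      ← dist_eq_norm]
    exact (mul_le_of_le_one_left dist_nonneg hθ.2).trans hR
  · have := dist_le_two_mul_dist_of_mem_segment_of_mem_ray hle (hZJ _ ha) (hZJ' _ hb)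
    linarith

theorem exists_radius_chordal_lt_of_omitted_value {n : ℕ} (hn : 2 ≤ n)
    {D : Set (EuclideanSpace ℝ (Fin n))} {Q : EuclideanSpace ℝ (Fin n) → ℝ≥0∞}
    (hQloc : ∀ K : Set (EuclideanSpace ℝ (Fin n)), IsCompact K → (∫⁻ y in K, Q y) < ∞)
    {x₀ : EuclideanSpace ℝ (Fin n)} {C : ℝ} (hC : 0 < C) (hCD : closedBall x₀ C ⊆ D)
    (y₁ : EuclideanSpace ℝ (Fin n)) {ε : ℝ} (hε : 0 < ε) :
    ∃ r > (0 : ℝ), ∀ f : EuclideanSpace ℝ (Fin n) → EuclideanSpace ℝ (Fin n),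
      ContinuousOn f D → IsOpenOn n D f → (∀ y, InvPoletsky n D f Q y) →
      (∀ x ∈ ball x₀ C, f x ≠ y₁) → ∀ x₁ ∈ ball x₀ r, ∀ x₂ ∈ ball x₀ r,
      chordal n (f x₁) (f x₂) < ε := by
  obtain ⟨r, hr, h⟩ := exists_radius_dist_lt_of_omitted_value hn hQloc hC hCD y₁
    (2 / ε + ‖y₁‖) (half_pos hε)
  refine ⟨r, hr, fun f hf hfo hP hom => ?_⟩
  have key : ∀ x₁ ∈ ball x₀ r, ∀ x₂ ∈ ball x₀ r, dist (f x₁) y₁ ≤ dist (f x₂) y₁ →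
      chordal n (f x₁) (f x₂) < ε := by
    intro x₁ hx₁ x₂ hx₂ hle
    by_contra! hcon
    have hnorm : ∀ w : EuclideanSpace ℝ (Fin n), ‖w‖ ≤ 2 / ε → dist w y₁ ≤ 2 / ε + ‖y₁‖ :=
      fun w hw => (dist_le_norm_add_norm w y₁).trans (by gcongr)
    have hR : dist (f x₁) y₁ ≤ 2 / ε + ‖y₁‖ := by
      rcases norm_le_or_norm_le_of_le_chordal hε hcon with h' | h'
      · exact hnorm _ h'
      · exact hle.trans (hnorm _ h')
    have := h f hf hfo hP hom x₁ hx₁ x₂ hx₂ hR hle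
    have := hcon.trans (chordal_le_dist n _ _)
    linarith
  intro x₁ hx₁ x₂ hx₂
  rcases le_total (dist (f x₁) y₁) (dist (f x₂) y₁) with hle | hle
  · exact key x₁ hx₁ x₂ hx₂ hle
  · rw [chordal_comm]
    exact key x₂ hx₂ x₁ hx₁ hle

/-- **Corollary 2 (equicontinuity via the cluster set, locally integrable `Q`).** -/
theorem equicontinuity_of_family_with_cluster_point_of_locInt
    (n : ℕ) (hn : 2 ≤ n)
    (D : Set (EuclideanSpace ℝ (Fin n))) (hD : IsOpen D) (hDconn : IsConnected D)
    (Q : EuclideanSpace ℝ (Fin n) → ℝ≥0∞) (hQmeas : Measurable Q)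
    (hQloc : ∀ K : Set (EuclideanSpace ℝ (Fin n)), IsCompact K → (∫⁻ y in K, Q y) < ∞)
    (𝓕 : Set (EuclideanSpace ℝ (Fin n) → EuclideanSpace ℝ (Fin n)))
    (h𝓕 : ∀ f ∈ 𝓕, ContinuousOn f D ∧ IsOpenOn n D f ∧ IsDiscreteOn n D f ∧
      ∀ y₀, InvPoletsky n D f Q y₀)
    (x₀ : EuclideanSpace ℝ (Fin n)) (hx₀ : x₀ ∈ D)
    (y₀ : EuclideanSpace ℝ (Fin n))
    -- `y₀` belongs to the cluster set `C(x₀, 𝓕)`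
    (hy₀ : ∃ (x : ℕ → EuclideanSpace ℝ (Fin n))
      (g : ℕ → (EuclideanSpace ℝ (Fin n) → EuclideanSpace ℝ (Fin n))),
      (∀ k, x k ∈ D) ∧ (∀ k, g k ∈ 𝓕) ∧ Tendsto x atTop (nhds x₀) ∧
        Tendsto (fun k => g k (x k)) atTop (nhds y₀))
    (r₀ : ℝ) (hr₀ : 0 < r₀)
    (y : ℕ → EuclideanSpace ℝ (Fin n))
    (hyball : ∀ m, y m ∈ Metric.ball y₀ r₀) (hyne : ∀ m, y m ≠ y₀)
    (hytend : Tendsto y atTop (nhds y₀))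
    (hdist : ∀ m : ℕ, ∃ C > (0 : ℝ), ∀ x ∈ D, (∃ f ∈ 𝓕, f x = y m) → C ≤ dist x₀ x) :
    EquicontinuousAtPt n D 𝓕 x₀ := by
  intro ε hε
  obtain ⟨C, hC, hCy⟩ := hdist 0
  obtain ⟨C', hC', hC'D⟩ := nhds_basis_closedBall.mem_iff.1 (hD.mem_nhds hx₀)
  have hmin : closedBall x₀ (min C C') ⊆ D :=
    (closedBall_subset_closedBall (min_le_right _ _)).trans hC'D
  obtain ⟨r, hr, h⟩ := exists_radius_chordal_lt_of_omitted_value hn hQloc (lt_min hC hC') hmin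
    (y 0) hε
  refine ⟨r, hr, fun f hf x _ hx => ?_⟩
  obtain ⟨hfc, hfo, -, hfP⟩ := h𝓕 f hf
  refine h f hfc hfo hfP (fun w hw hwy => ?_) x hx x₀ (mem_ball_self hr)
  have h1 := hCy w (hmin (ball_subset_closedBall hw)) ⟨f, hf, hwy⟩
  rw [dist_comm] at h1
  exact (h1.trans_lt (hw.trans_le (min_le_left _ _))).false

end
end
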